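/- Under the standing hypotheses, no vertex of G lies in two distinct g-cycles of G. -/

import Mathlib

open SimpleGraph

/-- Two graphs have the same `k`-deck if there is a bijection between their `k`-element
vertex subsets under which corresponding induced subgraphs are isomorphic. -/
def SameDeck {V W : Type*} [Fintype V] [Fintype W] [DecidableEq V] [DecidableEq W]
    (G : SimpleGraph V) (H : SimpleGraph W) (k : ℕ) : Prop :=
  ∃ e : {s : Finset V // s.card = k} ≃ {s : Finset W // s.card = k},
    ∀ s : {s : Finset V // s.card = k},
      Nonempty ((G.induce (↑s.1 : Set V)) ≃g (H.induce (↑(e s).1 : Set W)))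

/-- A nonempty vertex set in which every vertex has at least two neighbours. -/
def IsCore {V : Type*} (X : SimpleGraph V) (S : Finset V) : Prop :=
  S.Nonempty ∧ ∀ p ∈ S, ∃ q ∈ S, ∃ r ∈ S, q ≠ r ∧ X.Adj p q ∧ X.Adj p r

theorem exists_isCycle_of_isCore {V : Type*} {X : SimpleGraph V} {S : Finset V}
    (hS : IsCore X S) : ∃ (v : V) (w : X.Walk v v), w.IsCycle ∧ ∀ p ∈ w.support, p ∈ S := by
  classical
  by_contra! hno
  have hac : (X.induce (S : Set V)).IsAcyclic := by
    intro a w hw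
    have hinj : Function.Injective (SimpleGraph.Embedding.induce (G := X) (S : Set V)).toHom :=
      (SimpleGraph.Embedding.induce (G := X) (S : Set V)).injective
    obtain ⟨p, hp, hpS⟩ := hno _ (w.map (SimpleGraph.Embedding.induce (G := X) (S : Set V)).toHom)
      (hw.map hinj)
    rw [SimpleGraph.Walk.support_map, List.mem_map] at hp
    obtain ⟨q, -, rfl⟩ := hp
    exact hpS q.2
  obtain ⟨⟨v, hv⟩, hS⟩ := hS
  let c := (X.induce (S : Set V)).connectedComponentMk ⟨v, hv⟩
  have htree := hac.isTree_connectedComponent c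
  have hdeg : ∀ x : c, ∃ y z : c, y ≠ z ∧ c.toSimpleGraph.Adj x y ∧ c.toSimpleGraph.Adj x z := by
    rintro ⟨⟨p, hp⟩, hpc⟩
    obtain ⟨q, hq, r, hr, hqr, hpq, hpr⟩ := hS p hp
    have hmem : ∀ q (hq : q ∈ S), X.Adj p q → (⟨q, hq⟩ : (S : Set V)) ∈ c.supp := by
      intro q hq hpq
      refine (SimpleGraph.ConnectedComponent.mem_supp_congr_adj c ?_).1 hpc
      exact hpq
    exact ⟨⟨⟨q, hq⟩, hmem q hq hpq⟩, ⟨⟨r, hr⟩, hmem r hr hpr⟩, by simpa using hqr, hpq, hpr⟩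
  have : Nontrivial c := by
    obtain ⟨y, z, hyz, -⟩ := hdeg ⟨⟨v, hv⟩, rfl⟩
    exact ⟨y, z, hyz⟩
  obtain ⟨x, hx⟩ := htree.exists_vert_degree_one_of_nontrivial
  obtain ⟨y, z, hyz, hy, hz⟩ := hdeg x
  rw [← SimpleGraph.card_neighborFinset_eq_degree, Finset.card_eq_one] at hx
  obtain ⟨t, ht⟩ := hx
  rw [← SimpleGraph.mem_neighborFinset, ht, Finset.mem_singleton] at hy hz
  exact hyz (hy.trans hz.symm)

theorem SimpleGraph.Walk.IsCycle.card_support_toFinset {V : Type*} [DecidableEq V]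
    {X : SimpleGraph V} {v : V} {w : X.Walk v v} (hw : w.IsCycle) :
    w.support.toFinset.card = w.length := by
  have h : w.support.toFinset = w.support.tail.toFinset := by
    ext p
    simp only [List.mem_toFinset]
    refine ⟨fun hp ↦ ?_, List.mem_of_mem_tail⟩
    rcases SimpleGraph.Walk.mem_support_iff w |>.1 hp with rfl | hp
    · exact SimpleGraph.Walk.end_mem_tail_support hw.not_nil
    · exact hp
  rw [h, List.toFinset_card_of_nodup hw.support_nodup]
  simp

theorem SimpleGraph.Walk.IsCycle.exists_adj_toSubgraph {V : Type*}
    {X : SimpleGraph V} {v p : V} {w : X.Walk v v} (hw : w.IsCycle) (hp : p ∈ w.support) :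
    ∃ q r, q ≠ r ∧ w.toSubgraph.Adj p q ∧ w.toSubgraph.Adj p r := by
  have h := hw.ncard_neighborSet_toSubgraph_eq_two hp
  rw [Set.ncard_eq_two] at h
  obtain ⟨q, r, hqr, h⟩ := h
  have hq : q ∈ w.toSubgraph.neighborSet p := by rw [h]; simp
  have hr : r ∈ w.toSubgraph.neighborSet p := by rw [h]; simp
  exact ⟨q, r, hqr, hq, hr⟩

theorem SimpleGraph.Walk.IsCycle.isCore {V : Type*} [DecidableEq V]
    {X : SimpleGraph V} {v : V} {w : X.Walk v v} (hw : w.IsCycle) :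
    IsCore X w.support.toFinset := by
  refine ⟨⟨v, by simp⟩, fun p hp ↦ ?_⟩
  obtain ⟨q, r, hqr, hq, hr⟩ := hw.exists_adj_toSubgraph (List.mem_toFinset.1 hp)
  refine ⟨q, ?_, r, ?_, hqr, hq.adj_sub, hr.adj_sub⟩
  · simpa using w.mem_verts_toSubgraph.1 hq.snd_mem
  · simpa using w.mem_verts_toSubgraph.1 hr.snd_mem

theorem le_card_of_isCore {V : Type*} {X : SimpleGraph V} {g : ℕ} (hg : X.egirth = g)
    {S : Finset V} (hS : IsCore X S) : g ≤ S.card := by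
  classical
  obtain ⟨v, w, hw, hsub⟩ := exists_isCycle_of_isCore hS
  have h1 := SimpleGraph.egirth_le_length hw
  rw [hg] at h1
  have h2 : g ≤ w.length := by exact_mod_cast h1
  rw [← hw.card_support_toFinset] at h2
  exact h2.trans (Finset.card_le_card fun p hp ↦ hsub p (List.mem_toFinset.1 hp))

/-- A core of minimum size can be enumerated along a cycle starting at any of its vertices. -/
theorem exists_enumeration {V : Type*} {X : SimpleGraph V} {m : ℕ}
    (hmin : ∀ S, IsCore X S → m + 1 ≤ S.card) {S : Finset V} (hS : IsCore X S)
    (hcard : S.card = m + 1) {v : V} (hv : v ∈ S) :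
    ∃ f : Fin (m + 1) → V, Function.Injective f ∧ (∀ p, p ∈ S ↔ ∃ i, f i = p) ∧
      (∀ i, X.Adj (f i) (f (i + 1))) ∧ f 0 = v := by
  classical
  obtain ⟨u, w, hw, hsub⟩ := exists_isCycle_of_isCore hS
  have hsub' : w.support.toFinset ⊆ S := fun p hp ↦ hsub p (List.mem_toFinset.1 hp)
  have hle := hmin _ hw.isCore
  have heq : w.support.toFinset = S := Finset.eq_of_subset_of_card_le hsub' (by omega)
  have hlen : w.length = m + 1 := by rw [← hw.card_support_toFinset, heq, hcard]
  let f : Fin (m + 1) → V := fun i ↦ w.getVert i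
  have hinj : Function.Injective f := by
    intro i j hij
    have := hw.getVert_injOn' (show (i : ℕ) ∈ {i | i ≤ w.length - 1} by simp; omega)
      (show (j : ℕ) ∈ {i | i ≤ w.length - 1} by simp; omega) hij
    exact Fin.ext this
  have hmem : ∀ i, f i ∈ S := fun i ↦ hsub _ (w.getVert_mem_support _)
  have hsurj : ∀ p ∈ S, ∃ i, f i = p := by
    have himg : Finset.univ.image f = S := by
      refine Finset.eq_of_subset_of_card_le ?_ ?_
      · intro p hp
        obtain ⟨i, -, rfl⟩ := Finset.mem_image.1 hp
        exact hmem i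
      · rw [Finset.card_image_of_injective _ hinj, hcard]
        simp
    intro p hp
    rw [← himg] at hp
    obtain ⟨i, -, rfl⟩ := Finset.mem_image.1 hp
    exact ⟨i, rfl⟩
  have hadj : ∀ i, X.Adj (f i) (f (i + 1)) := by
    intro i
    have h := w.adj_getVert_succ (i := i) (by omega)
    rcases Nat.lt_or_ge i m with hi | hi
    · have : ((i + 1 : Fin (m + 1)) : ℕ) = i + 1 :=
        Fin.val_add_one_of_lt (by rw [Fin.lt_def]; simpa using hi)
      simpa [f, this] using h
    · have hil : i = Fin.last m := by ext; simp; omega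
      subst hil
      have : w.getVert (m + 1) = u := by rw [← hlen]; exact w.getVert_length
      simpa [f, this] using h
  obtain ⟨k, rfl⟩ := hsurj v hv
  refine ⟨fun i ↦ f (i + k), fun i j hij ↦ add_right_cancel (hinj hij), fun p ↦ ⟨fun hp ↦ ?_, ?_⟩,
    fun i ↦ ?_, by simp⟩
  · obtain ⟨i, rfl⟩ := hsurj p hp
    exact ⟨i - k, by simp⟩
  · rintro ⟨i, rfl⟩
    exact hmem _
  · simpa [add_right_comm] using hadj (i + k)

/-- A core of minimum size has no vertex with three neighbours in the core. -/
theorem eq_or_eq_or_eq_of_isCore {V : Type*} {X : SimpleGraph V} {g : ℕ}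
    (hmin : ∀ S, IsCore X S → g ≤ S.card) {S : Finset V} (hS : IsCore X S)
    (hcard : S.card = g) {v p q r : V} (hv : v ∈ S) (hp : p ∈ S) (hq : q ∈ S) (hr : r ∈ S)
    (hvp : X.Adj v p) (hvq : X.Adj v q) (hvr : X.Adj v r) : p = q ∨ p = r ∨ q = r := by
  classical
  obtain ⟨m, rfl⟩ : ∃ m, g = m + 1 := ⟨g - 1, by
    have := Finset.card_pos.2 ⟨v, hv⟩
    omega⟩
  obtain ⟨f, hinj, hmem, hadj, rfl⟩ := exists_enumeration hmin hS hcard hv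
  have key : ∀ k, X.Adj (f 0) (f k) → (k : ℕ) = 1 ∨ (k : ℕ) = m := by
    intro k hk
    by_contra! hne
    have hk0 : (k : ℕ) ≠ 0 := by
      intro h
      have : k = 0 := Fin.ext h
      subst this
      exact hk.ne rfl
    have hadj' : ∀ i j : Fin (m + 1), (j : ℕ) = i + 1 → X.Adj (f i) (f j) := by
      intro i j hij
      have : j = i + 1 := by
        ext
        rw [Fin.val_add_one_of_lt (by rw [Fin.lt_def]; simp; omega), hij]
      rw [this]
      exact hadj i
    have hcore : IsCore X ((Finset.Iic k).image f) := by
      refine ⟨⟨f k, Finset.mem_image_of_mem _ (Finset.mem_Iic.2 le_rfl)⟩, fun p hp ↦ ?_⟩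
      obtain ⟨i, hi, rfl⟩ := Finset.mem_image.1 hp
      rw [Finset.mem_Iic, Fin.le_def] at hi
      have hI : ∀ j : Fin (m + 1), (j : ℕ) ≤ k → f j ∈ (Finset.Iic k).image f := fun j hj ↦
        Finset.mem_image_of_mem _ (Finset.mem_Iic.2 hj)
      have hne' : ∀ a b : Fin (m + 1), (a : ℕ) ≠ b → f a ≠ f b := fun a b h h' ↦
        h (congrArg Fin.val (hinj h'))
      rcases Nat.eq_zero_or_pos i with hi0 | hi0
      · have : i = 0 := Fin.ext hi0
        subst this
        exact ⟨f ⟨1, by omega⟩, hI _ (by simp; omega), f k, hI _ le_rfl, hne' _ _ (by simp; omega),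
          hadj' _ _ (by simp), hk⟩
      · rcases Nat.lt_or_ge i k with hik | hik
        · exact ⟨f ⟨i - 1, by omega⟩, hI _ (by simp; omega), f ⟨i + 1, by omega⟩,
            hI _ (by simp; omega), hne' _ _ (by simp), (hadj' _ _ (by simp; omega)).symm,
            hadj' _ _ (by simp)⟩
        · have : i = k := Fin.ext (by omega)
          subst this
          exact ⟨f ⟨i - 1, by omega⟩, hI _ (by simp), f 0, hI _ (by simp),
            hne' _ _ (by simp; omega), (hadj' _ _ (by simp; omega)).symm, hk.symm⟩
    have := hmin _ hcore
    rw [Finset.card_image_of_injective _ hinj, Fin.card_Iic] at this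
    omega
  obtain ⟨a, rfl⟩ := (hmem p).1 hp
  obtain ⟨b, rfl⟩ := (hmem q).1 hq
  obtain ⟨c, rfl⟩ := (hmem r).1 hr
  have ha := key a hvp
  have hb := key b hvq
  have hc := key c hvr
  have : a = b ∨ a = c ∨ b = c := by
    simp only [Fin.ext_iff]
    omega
  rcases this with h | h | h <;> simp [h]

theorem SameDeck.symm {V W : Type*} [Fintype V] [Fintype W] [DecidableEq V] [DecidableEq W]
    {G : SimpleGraph V} {H : SimpleGraph W} {k : ℕ} (h : SameDeck G H k) : SameDeck H G k := by
  obtain ⟨e, he⟩ := h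
  refine ⟨e.symm, fun s ↦ ?_⟩
  obtain ⟨φ⟩ := he (e.symm s)
  rw [e.apply_symm_apply] at φ
  exact ⟨φ.symm⟩

theorem SameDeck.congr_right {V W U : Type*} [Fintype V] [Fintype W] [Fintype U] [DecidableEq V]
    [DecidableEq W] [DecidableEq U] {G : SimpleGraph V} {H : SimpleGraph W} {K : SimpleGraph U}
    {k : ℕ} (h : SameDeck G H k) (φ : H ≃g K) : SameDeck G K k := by
  obtain ⟨e, he⟩ := h
  let m : {s : Finset W // s.card = k} ≃ {s : Finset U // s.card = k} :=
    φ.toEquiv.finsetCongr.subtypeEquiv (by simp)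
  refine ⟨e.trans m, fun s ↦ ?_⟩
  obtain ⟨ψ⟩ := he s
  have hm : ((m (e s)).1 : Set U) = φ '' ((e s).1 : Set W) := by
    ext; simp [m]
  have θ : H.induce ((e s).1 : Set W) ≃g K.induce (φ '' ((e s).1 : Set W)) :=
    { toEquiv := φ.toEquiv.image _
      map_rel_iff' := by
        rintro ⟨a, ha⟩ ⟨b, hb⟩
        exact φ.map_rel_iff }
  rw [Equiv.trans_apply, hm]
  exact ⟨ψ.trans θ⟩

/-- Corresponding cards of two graphs on the same vertex set are matched by a permutation. -/
theorem SameDeck.exists_perm {V : Type*} [Fintype V] [DecidableEq V] {X Y : SimpleGraph V} {k : ℕ}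
    (h : SameDeck X Y k) : ∃ e : {s : Finset V // s.card = k} ≃ {s : Finset V // s.card = k},
      ∀ T, ∃ ψ : Equiv.Perm V, (∀ p ∈ T.1, ψ p ∈ (e T).1) ∧
        ∀ p ∈ T.1, ∀ q ∈ T.1, (X.Adj p q ↔ Y.Adj (ψ p) (ψ q)) := by
  classical
  obtain ⟨e, he⟩ := h
  refine ⟨e, fun T ↦ ?_⟩
  obtain ⟨φ⟩ := he T
  let φ' : {p // p ∈ T.1} ≃ {p // p ∈ (e T).1} := φ.toEquiv
  have happ : ∀ p (hp : p ∈ T.1), φ'.extendSubtype p = φ' ⟨p, hp⟩ := fun p hp ↦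
    φ'.extendSubtype_apply_of_mem p hp
  refine ⟨φ'.extendSubtype, fun p hp ↦ ?_, fun p hp q hq ↦ ?_⟩
  · rw [happ p hp]
    exact (φ' ⟨p, hp⟩).2
  · rw [happ p hp, happ q hq]
    exact (φ.map_rel_iff (a := ⟨p, hp⟩) (b := ⟨q, hq⟩)).symm

/-- Given a vertex pair, the second graph can be redrawn to agree with the first one away from
that pair. -/
theorem SameDeck.exists_iso_agree {V : Type*} [Fintype V] [DecidableEq V] {X Y : SimpleGraph V}
    (h : SameDeck X Y (Fintype.card V - 2)) {u v : V} (huv : u ≠ v) :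
    ∃ Z : SimpleGraph V, Nonempty (Y ≃g Z) ∧
      ∀ p q, p ≠ u → p ≠ v → q ≠ u → q ≠ v → (Z.Adj p q ↔ X.Adj p q) := by
  obtain ⟨e, he⟩ := h.exists_perm
  have hcard : (({u, v} : Finset V)ᶜ).card = Fintype.card V - 2 := by
    rw [Finset.card_compl, Finset.card_pair huv]
  obtain ⟨ψ, -, hψ⟩ := he ⟨({u, v} : Finset V)ᶜ, hcard⟩
  refine ⟨Y.comap ψ, ⟨(SimpleGraph.Iso.comap ψ Y).symm⟩, fun p q hpu hpv hqu hqv ↦ ?_⟩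
  exact (hψ p (by simp [hpu, hpv]) q (by simp [hqu, hqv])).symm

theorem IsCore.image {V W : Type*} [DecidableEq W] {X : SimpleGraph V} {Y : SimpleGraph W}
    {S : Finset V} (hS : IsCore X S) {ψ : V → W} (hinj : Function.Injective ψ)
    (hψ : ∀ p ∈ S, ∀ q ∈ S, X.Adj p q → Y.Adj (ψ p) (ψ q)) : IsCore Y (S.image ψ) := by
  refine ⟨hS.1.image ψ, fun x hx ↦ ?_⟩
  obtain ⟨p, hp, rfl⟩ := Finset.mem_image.1 hx
  obtain ⟨q, hq, r, hr, hqr, hpq, hpr⟩ := hS.2 p hp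
  exact ⟨ψ q, Finset.mem_image_of_mem _ hq, ψ r, Finset.mem_image_of_mem _ hr, hinj.ne hqr,
    hψ p hp q hq hpq, hψ p hp r hr hpr⟩

theorem IsCore.exists_eq_of_card_eq_three {V : Type*} [DecidableEq V] {X : SimpleGraph V}
    {S : Finset V} (hS : IsCore X S) (hcard : S.card = 3) {x : V} (hx : x ∈ S) :
    ∃ p q, p ≠ q ∧ X.Adj x p ∧ X.Adj x q ∧ X.Adj p q ∧ S = {x, p, q} := by
  have key : ∀ x ∈ S, ∃ p q, p ≠ q ∧ X.Adj x p ∧ X.Adj x q ∧ S = {x, p, q} := by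
    intro x hx
    obtain ⟨p, hp, q, hq, hpq, hxp, hxq⟩ := hS.2 x hx
    refine ⟨p, q, hpq, hxp, hxq, (Finset.eq_of_subset_of_card_le ?_ ?_).symm⟩
    · simp [Finset.insert_subset_iff, hx, hp, hq]
    · rw [hcard, Finset.card_eq_three.2 ⟨x, p, q, hxp.ne, hxq.ne, hpq, rfl⟩]
  obtain ⟨p, q, hpq, hxp, hxq, hSeq⟩ := key x hx
  obtain ⟨r, s, -, hpr, hps, hSeq'⟩ := key p (by simp [hSeq])
  have hq : q ∈ ({p, r, s} : Finset V) := by simp [← hSeq', hSeq]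
  simp only [Finset.mem_insert, Finset.mem_singleton] at hq
  refine ⟨p, q, hpq, hxp, hxq, ?_, hSeq⟩
  rcases hq with rfl | rfl | rfl
  · exact (hpq rfl).elim
  · exact hpr
  · exact hps

open Classical in
/-- The cores with exactly `k` vertices. -/
noncomputable def coresOfCard {V : Type*} [Fintype V] (X : SimpleGraph V) (k : ℕ) :
    Finset (Finset V) :=
  {S | IsCore X S ∧ S.card = k}

theorem mem_coresOfCard {V : Type*} [Fintype V] {X : SimpleGraph V} {k : ℕ} {S : Finset V} :
    S ∈ coresOfCard X k ↔ IsCore X S ∧ S.card = k := by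
  simp [coresOfCard]

theorem card_filter_subset_and_card_eq {V : Type*} [Fintype V] [DecidableEq V] (S : Finset V)
    (m : ℕ) (hm : S.card ≤ m) :
    ({T | S ⊆ T ∧ T.card = m} : Finset (Finset V)).card
      = (Fintype.card V - S.card).choose (m - S.card) := by
  rw [← Finset.card_compl, ← Finset.card_powersetCard]
  refine Finset.card_bij' (fun T _ ↦ T \ S) (fun T _ ↦ S ∪ T) ?_ ?_ ?_ ?_
  · intro T hT
    simp only [Finset.mem_filter, Finset.mem_univ, true_and] at hT
    rw [Finset.mem_powersetCard, Finset.card_sdiff_of_subset hT.1, hT.2]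
    exact ⟨fun p hp ↦ by simp at hp ⊢; exact hp.2, rfl⟩
  · intro T hT
    rw [Finset.mem_powersetCard] at hT
    have hd : Disjoint S T := (disjoint_compl_right (a := S)).mono_right hT.1
    simp only [Finset.mem_filter, Finset.mem_univ, true_and]
    rw [Finset.card_union_of_disjoint hd]
    exact ⟨Finset.subset_union_left, by omega⟩
  · intro T hT
    simp only [Finset.mem_filter, Finset.mem_univ, true_and] at hT
    exact Finset.union_sdiff_of_subset hT.1
  · intro T hT
    rw [Finset.mem_powersetCard] at hT
    have hd : Disjoint S T := (disjoint_compl_right (a := S)).mono_right hT.1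
    rw [Finset.union_sdiff_cancel_left hd]

/-- Kelly's counting argument: a core contained in some card is counted by the deck. -/
theorem SameDeck.card_coresOfCard {V : Type*} [Fintype V] [DecidableEq V] {X Y : SimpleGraph V}
    {k m : ℕ} (h : SameDeck X Y m) (hkm : k ≤ m) (hm : m ≤ Fintype.card V) :
    (coresOfCard X k).card = (coresOfCard Y k).card := by
  classical
  suffices hle : ∀ X Y : SimpleGraph V, SameDeck X Y m →
      (coresOfCard X k).card ≤ (coresOfCard Y k).card from
    le_antisymm (hle X Y h) (hle Y X h.symm)
  intro X Y h
  have hcount : ∀ X : SimpleGraph V,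
      (coresOfCard X k).card * (Fintype.card V - k).choose (m - k) =
        ∑ T : {s : Finset V // s.card = m}, ((coresOfCard X k).filter (· ⊆ T.1)).card := by
    intro X
    have h1 := Finset.sum_card_bipartiteAbove_eq_sum_card_bipartiteBelow
      (s := coresOfCard X k) (t := ({T | T.card = m} : Finset (Finset V))) (fun S T ↦ S ⊆ T)
    rw [← Finset.sum_subtype (p := fun s : Finset V ↦ s.card = m)
      ({T | T.card = m} : Finset (Finset V)) (by simp)
      (fun T ↦ ((coresOfCard X k).filter (· ⊆ T)).card)]
    refine Eq.trans ?_ h1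
    rw [Finset.sum_congr rfl (g := fun _ ↦ (Fintype.card V - k).choose (m - k)), Finset.sum_const,
      smul_eq_mul]
    intro S hS
    have hSk := (mem_coresOfCard.1 hS).2
    rw [← hSk, ← card_filter_subset_and_card_eq S m (hSk ▸ hkm), Finset.bipartiteAbove,
      Finset.filter_filter]
    simp only [and_comm]
  have hpos : 0 < (Fintype.card V - k).choose (m - k) := Nat.choose_pos (by omega)
  refine Nat.le_of_mul_le_mul_right ?_ hpos
  rw [hcount X, hcount Y]
  obtain ⟨e, he⟩ := h.exists_perm
  rw [← e.sum_comp fun T ↦ ((coresOfCard Y k).filter (· ⊆ T.1)).card]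
  refine Finset.sum_le_sum fun T _ ↦ ?_
  obtain ⟨ψ, hT, hψ⟩ := he T
  refine Finset.card_le_card_of_injOn (fun S ↦ S.image ψ) ?_
    ((Finset.image_injective ψ.injective).injOn)
  intro S hS
  simp only [Finset.coe_filter, Set.mem_ofPred_eq, mem_coresOfCard] at hS ⊢
  obtain ⟨⟨hS, hc⟩, hST⟩ := hS
  refine ⟨⟨hS.image ψ.injective fun p hp q hq ↦ (hψ p (hST hp) q (hST hq)).1, ?_⟩, ?_⟩
  · rw [Finset.card_image_of_injective _ ψ.injective, hc]
  · intro x hx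
    obtain ⟨p, hp, rfl⟩ := Finset.mem_image.1 hx
    exact hT p (hST hp)

/-- The neighbours of `p` are exactly the three distinct vertices `a`, `b`, `c`. -/
def HasNeighbors {V : Type*} (X : SimpleGraph V) (p a b c : V) : Prop :=
  a ≠ b ∧ a ≠ c ∧ b ≠ c ∧ ∀ q, X.Adj p q ↔ q = a ∨ q = b ∨ q = c

/-- Every vertex has exactly three neighbours. -/
def IsCubic {V : Type*} (X : SimpleGraph V) : Prop :=
  ∀ p, ∃ a b c, HasNeighbors X p a b c

theorem IsCubic.of_iso {V W : Type*} {X : SimpleGraph V} {Y : SimpleGraph W} (hX : IsCubic X)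
    (φ : X ≃g Y) : IsCubic Y := by
  intro p
  obtain ⟨a, b, c, hab, hac, hbc, h⟩ := hX (φ.symm p)
  refine ⟨φ a, φ b, φ c, by simpa, by simpa, by simpa, fun q ↦ ?_⟩
  rw [← φ.symm.map_adj_iff, h]
  simp [RelIso.symm_apply_eq]

theorem IsCubic.hasNeighbors {V : Type*} {X : SimpleGraph V} (hX : IsCubic X) {p a b c : V}
    (hab : a ≠ b) (hac : a ≠ c) (hbc : b ≠ c) (ha : X.Adj p a) (hb : X.Adj p b)
    (hc : X.Adj p c) : HasNeighbors X p a b c := by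
  obtain ⟨x, y, z, hxy, hxz, hyz, h⟩ := hX p
  refine ⟨hab, hac, hbc, fun q ↦ ?_⟩
  rw [h] at ha hb hc ⊢
  grind

theorem IsCubic.exists_hasNeighbors {V : Type*} {X : SimpleGraph V} (hX : IsCubic X) {p a : V}
    (ha : X.Adj p a) : ∃ b c, HasNeighbors X p a b c := by
  obtain ⟨x, y, z, hxy, hxz, hyz, h⟩ := hX p
  rcases (h a).1 ha with rfl | rfl | rfl
  · exact ⟨y, z, hxy, hxz, hyz, h⟩
  · exact ⟨x, z, hxy.symm, hyz, hxz, by grind⟩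
  · exact ⟨x, y, hxz.symm, hyz.symm, hxy, by grind⟩

theorem HasNeighbors.perm_right {V : Type*} {X : SimpleGraph V} {p a b c : V}
    (h : HasNeighbors X p a b c) : HasNeighbors X p a c b := by
  unfold HasNeighbors at *
  grind

theorem HasNeighbors.perm_left {V : Type*} {X : SimpleGraph V} {p a b c : V}
    (h : HasNeighbors X p a b c) : HasNeighbors X p b a c := by
  unfold HasNeighbors at *
  grind

open Classical in
theorem IsCubic.sum_adj {V : Type*} {X : SimpleGraph V} (hX : IsCubic X) {p : V}
    {S : Finset V} (hS : ∀ q, X.Adj p q → q ∈ S) :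
    ∑ q ∈ S, (if X.Adj p q then 1 else 0) = 3 := by
  obtain ⟨a, b, c, hab, hac, hbc, h⟩ := hX p
  rw [← Finset.card_filter]
  have : S.filter (fun q ↦ X.Adj p q) = {a, b, c} := by
    ext q
    have := hS q
    simp only [Finset.mem_filter, Finset.mem_insert, Finset.mem_singleton]
    grind
  rw [this, Finset.card_eq_three]
  exact ⟨a, b, c, hab, hac, hbc, rfl⟩

open Classical in
theorem sum_adj_pair_eq {V : Type*} [Fintype V] {X Y : SimpleGraph V} (hX : IsCubic X)
    (hY : IsCubic Y) {u v : V} (huv : u ≠ v)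
    (h : ∀ p q, p ≠ u → p ≠ v → q ≠ u → q ≠ v → (Y.Adj p q ↔ X.Adj p q)) {p : V} (hpu : p ≠ u)
    (hpv : p ≠ v) :
    (if Y.Adj u p then 1 else 0) + (if Y.Adj v p then 1 else 0) =
      (if X.Adj u p then 1 else 0) + (if X.Adj v p then 1 else 0) := by
  have hsplit : ∀ X : SimpleGraph V, IsCubic X →
      (∑ q ∈ ({u, v} : Finset V)ᶜ, if X.Adj p q then 1 else 0) +
        ((if X.Adj u p then 1 else 0) + (if X.Adj v p then 1 else 0)) = 3 := by
    intro X hX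
    rw [← hX.sum_adj (p := p) (S := Finset.univ) (by simp), ← Finset.sum_compl_add_sum {u, v},
      Finset.sum_pair huv, X.adj_comm p u, X.adj_comm p v]
  have h1 := hsplit X hX
  have h2 := hsplit Y hY
  rw [Finset.sum_congr rfl (g := fun q ↦ if X.Adj p q then 1 else 0)] at h2
  · omega
  · intro q hq
    simp only [Finset.mem_compl, Finset.mem_insert, Finset.mem_singleton, not_or] at hq
    simp only [h p q hpu hpv hq.1 hq.2]

/-- Two non-isomorphic cubic graphs on the same vertices that agree on all cards missing two
vertices. -/
def IsTwin {V : Type*} [Fintype V] [DecidableEq V] (X Y : SimpleGraph V) : Prop :=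
  IsCubic X ∧ IsCubic Y ∧ SameDeck X Y (Fintype.card V - 2) ∧ IsEmpty (X ≃g Y)

section

variable {V : Type*} [Fintype V] [DecidableEq V] {X Y Z : SimpleGraph V}

theorem IsTwin.symm (h : IsTwin X Y) : IsTwin Y X :=
  ⟨h.2.1, h.1, h.2.2.1.symm, ⟨fun φ ↦ h.2.2.2.false φ.symm⟩⟩

theorem IsTwin.of_iso (h : IsTwin X Y) (φ : Y ≃g Z) : IsTwin X Z :=
  ⟨h.1, h.2.1.of_iso φ, h.2.2.1.congr_right φ, ⟨fun ψ ↦ h.2.2.2.false (ψ.trans φ.symm)⟩⟩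

theorem IsTwin.exists_agree (h : IsTwin X Y) {u v : V} (huv : u ≠ v) :
    ∃ Z, IsTwin X Z ∧
      ∀ p q, p ≠ u → p ≠ v → q ≠ u → q ≠ v → (Z.Adj p q ↔ X.Adj p q) := by
  obtain ⟨Z, ⟨φ⟩, hZ⟩ := h.2.2.1.exists_iso_agree huv
  exact ⟨Z, h.of_iso φ, hZ⟩

theorem IsTwin.ne (h : IsTwin X Y) : Y ≠ X := by
  rintro rfl
  exact h.2.2.2.false (RelIso.refl _)

/-- Two triangles with a common edge are impossible. -/
theorem IsTwin.false_of_diamond (h : IsTwin X Y) {u v a c : V} (hu : HasNeighbors X u v a c)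
    (hv : HasNeighbors X v u a c) : False := by
  classical
  obtain ⟨hva, hvc, hac, hu⟩ := hu
  obtain ⟨hua, huc, -, hv⟩ := hv
  have huv : u ≠ v := by
    rintro rfl
    simpa using (hu u).2 (Or.inl rfl)
  obtain ⟨Z, hZ, hag⟩ := h.exists_agree huv
  have hind := fun p ↦ sum_adj_pair_eq h.1 hZ.2.1 huv hag (p := p)
  have hu0 := hZ.2.1.sum_adj (p := u) (S := {v, a, c}) (by
    intro q hq
    have := hind q hq.ne'
    by_cases hqv : q = v
    · simp [hqv]
    · have := this hqv
      simp only [hu, hv, hq, hqv, hq.ne'] at this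
      simp only [Finset.mem_insert, Finset.mem_singleton]
      grind)
  have hu1 : HasNeighbors Z u v a c := by
    refine hZ.2.1.hasNeighbors hva hvc hac ?_ ?_ ?_ <;>
    · by_contra hn
      rw [Finset.sum_insert (by simp [hva, hvc]), Finset.sum_pair hac] at hu0
      grind
  have hv1 : HasNeighbors Z v u a c := by
    refine hZ.2.1.hasNeighbors hua huc hac ((hu1.2.2.2 v).2 (by simp)).symm ?_ ?_
    · have := hind a hua.symm hva.symm
      simp only [hu1.2.2.2, hu, hv] at this
      grind
    · have := hind c huc.symm hvc.symm
      simp only [hu1.2.2.2, hu, hv] at this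
      grind
  refine hZ.ne ?_
  ext p q
  by_cases hpu : p = u
  · rw [hpu, hu1.2.2.2, hu]
  by_cases hpv : p = v
  · rw [hpv, hv1.2.2.2, hv]
  by_cases hqu : q = u
  · rw [hqu, Z.adj_comm, X.adj_comm, hu1.2.2.2, hu]
  by_cases hqv : q = v
  · rw [hqv, Z.adj_comm, X.adj_comm, hv1.2.2.2, hv]
  exact hag p q hpu hpv hqu hqv

/-- Redrawing the twin so that it agrees with `X` off an edge in no triangle only swaps two of the
four outer neighbours of the edge. -/
theorem IsTwin.exists_agree_edge (h : IsTwin X Y) {u v a b c d : V} (hu : HasNeighbors X u v a b)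
    (hv : HasNeighbors X v u c d) (hac : a ≠ c) (had : a ≠ d) (hbc : b ≠ c) (hbd : b ≠ d) :
    ∃ Z, IsTwin X Z ∧
      (∀ p q, p ≠ u → p ≠ v → q ≠ u → q ≠ v → (Z.Adj p q ↔ X.Adj p q)) ∧
      ((HasNeighbors Z u v a c ∧ HasNeighbors Z v u b d) ∨
        (HasNeighbors Z u v a d ∧ HasNeighbors Z v u b c)) := by
  classical
  obtain ⟨hva, hvb, hab, hu⟩ := hu
  obtain ⟨huc, hud, hcd, hv⟩ := hv
  have huv : u ≠ v := by
    rintro rfl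
    simpa using (hu u).2 (Or.inl rfl)
  have hua : u ≠ a := by
    rintro rfl
    simpa using (hu u).2 (by simp)
  have hub : u ≠ b := by
    rintro rfl
    simpa using (hu u).2 (by simp)
  have hvc : v ≠ c := by
    rintro rfl
    simpa using (hv v).2 (by simp)
  have hvd : v ≠ d := by
    rintro rfl
    simpa using (hv v).2 (by simp)
  suffices hmain : ∀ Z, IsTwin X Z →
      (∀ p q, p ≠ u → p ≠ v → q ≠ u → q ≠ v → (Z.Adj p q ↔ X.Adj p q)) → Z.Adj u a →
      ((HasNeighbors Z u v a c ∧ HasNeighbors Z v u b d) ∨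
        (HasNeighbors Z u v a d ∧ HasNeighbors Z v u b c)) by
    obtain ⟨Z, hZ, hag⟩ := h.exists_agree huv
    by_cases hZa : Z.Adj u a
    · exact ⟨Z, hZ, hag, hmain Z hZ hag hZa⟩
    · let Z' := Z.comap (Equiv.swap u v)
      have hZ' : IsTwin X Z' := hZ.of_iso (SimpleGraph.Iso.comap (Equiv.swap u v) Z).symm
      have hag' : ∀ p q, p ≠ u → p ≠ v → q ≠ u → q ≠ v → (Z'.Adj p q ↔ X.Adj p q) := by
        intro p q hpu hpv hqu hqv
        rw [← hag p q hpu hpv hqu hqv]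
        simp [Z', Equiv.swap_apply_of_ne_of_ne, *]
      refine ⟨Z', hZ', hag', hmain Z' hZ' hag' ?_⟩
      have := sum_adj_pair_eq h.1 hZ.2.1 huv hag hua.symm hva.symm
      have h2 : Z'.Adj u a ↔ Z.Adj v a := by
        simp [Z', Equiv.swap_apply_of_ne_of_ne hua.symm hva.symm]
      rw [h2]
      simp only [hu, hv] at this
      grind
  intro Z hZ hag hZa
  have hind := fun p ↦ sum_adj_pair_eq h.1 hZ.2.1 huv hag (p := p)
  have hnb : ∀ q, q ≠ u → q ≠ v → Z.Adj u q ∨ Z.Adj v q → q = a ∨ q = b ∨ q = c ∨ q = d := by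
    intro q hqu hqv hq
    have := hind q hqu hqv
    simp only [hu, hv] at this
    grind
  have hsu := hZ.2.1.sum_adj (p := u) (S := {v, a, b, c, d}) (by
    intro q hq
    have := hnb q hq.ne'
    simp only [Finset.mem_insert, Finset.mem_singleton]
    grind)
  have hsv := hZ.2.1.sum_adj (p := v) (S := {u, a, b, c, d}) (by
    intro q hq
    have := fun h ↦ hnb q h hq.ne'
    simp only [Finset.mem_insert, Finset.mem_singleton]
    grind)
  rw [Finset.sum_insert (by simp [*]), Finset.sum_insert (by simp [*]),
    Finset.sum_insert (by simp [*]), Finset.sum_pair hcd] at hsu hsv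
  have ha := hind a hua.symm hva.symm
  have hb := hind b hub.symm hvb.symm
  have hc := hind c huc.symm hvc.symm
  have hd := hind d hud.symm hvd.symm
  rw [Z.adj_comm v u] at hsv
  simp only [hu, hv] at ha hb hc hd
  have hZuv : Z.Adj u v := by
    by_contra hn
    simp only [hn] at hsu hsv
    grind
  have hZvb : ¬ Z.Adj u b := by
    intro hZb
    have hZu : HasNeighbors Z u v a b := hZ.2.1.hasNeighbors hva hvb hab hZuv hZa hZb
    have hZv : HasNeighbors Z v u c d := by
      refine hZ.2.1.hasNeighbors huc hud hcd hZuv.symm ?_ ?_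
      · have := hZu.2.2.2 c
        grind
      · have := hZu.2.2.2 d
        grind
    refine hZ.ne ?_
    ext p q
    by_cases hpu : p = u
    · rw [hpu, hZu.2.2.2, hu]
    by_cases hpv : p = v
    · rw [hpv, hZv.2.2.2, hv]
    by_cases hqu : q = u
    · rw [hqu, Z.adj_comm, X.adj_comm, hZu.2.2.2, hu]
    by_cases hqv : q = v
    · rw [hqv, Z.adj_comm, X.adj_comm, hZv.2.2.2, hv]
    exact hag p q hpu hpv hqu hqv
  have hZb : Z.Adj v b := by grind
  by_cases hZc : Z.Adj u c
  · left
    have hZu := hZ.2.1.hasNeighbors hva hvc hac hZuv hZa hZc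
    refine ⟨hZu, hZ.2.1.hasNeighbors hub hud hbd hZuv.symm hZb ?_⟩
    have := hZu.2.2.2 d
    grind
  · right
    have hZc' : Z.Adj v c := by grind
    have hZv := hZ.2.1.hasNeighbors hub huc hbc hZuv.symm hZb hZc'
    refine ⟨hZ.2.1.hasNeighbors hva hvd had hZuv hZa ?_, hZv⟩
    have := hZv.2.2.2 d
    grind

end

/-- A cubic graph all of whose cores have at least `g` vertices and which has a twin. -/
def IsTwinned {V : Type*} [Fintype V] [DecidableEq V] (g : ℕ) (X : SimpleGraph V) : Prop :=
  (∀ S, IsCore X S → g ≤ S.card) ∧ ∃ Y, IsTwin X Y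

section

variable {V : Type*} [Fintype V] [DecidableEq V] {X Y Z : SimpleGraph V} {g : ℕ}

theorem IsTwinned.isCubic (h : IsTwinned g X) : IsCubic X :=
  let ⟨_, _, hY⟩ := h
  hY.1

theorem IsTwinned.not_adj (h : IsTwinned g X) (hg : 4 ≤ g) {p q r : V} (hpq : X.Adj p q)
    (hpr : X.Adj p r) : ¬ X.Adj q r := by
  intro hqr
  have hcore : IsCore X {p, q, r} := by
    refine ⟨by simp, fun x hx ↦ ?_⟩
    simp only [Finset.mem_insert, Finset.mem_singleton] at hx
    rcases hx with rfl | rfl | rfl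
    · exact ⟨q, by simp, r, by simp, hqr.ne, hpq, hpr⟩
    · exact ⟨p, by simp, r, by simp, hpr.ne, hpq.symm, hqr⟩
    · exact ⟨p, by simp, q, by simp, hpq.ne, hpr.symm, hqr.symm⟩
  have := h.1 _ hcore
  have := Finset.card_le_three (a := p) (b := q) (c := r)
  omega

theorem IsTwinned.notMem (h : IsTwinned g X) {S : Finset V} (hS : IsCore X S)
    (hcard : S.card = g) {p a b c : V} (hp : p ∈ S) (hn : HasNeighbors X p a b c)
    (ha : a ∈ S) (hb : b ∈ S) : c ∉ S := by
  intro hc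
  obtain ⟨hab, hac, hbc, hn⟩ := hn
  rcases eq_or_eq_or_eq_of_isCore h.1 hS hcard hp ha hb hc ((hn a).2 (by simp))
    ((hn b).2 (by simp)) ((hn c).2 (by simp)) with h | h | h <;> contradiction

/-- Each vertex of a minimum core has two neighbours in it and one outside. -/
theorem IsTwinned.exists_hasNeighbors (h : IsTwinned g X) {S : Finset V} (hS : IsCore X S)
    (hcard : S.card = g) {p a : V} (hp : p ∈ S) (ha : a ∈ S) (hpa : X.Adj p a) :
    ∃ b c, HasNeighbors X p a b c ∧ b ∈ S ∧ c ∉ S := by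
  obtain ⟨b, c, hn⟩ := h.isCubic.exists_hasNeighbors hpa
  by_cases hb : b ∈ S
  · exact ⟨b, c, hn, hb, h.notMem hS hcard hp hn ha hb⟩
  · obtain ⟨q, hq, r, hr, hqr, hpq, hpr⟩ := hS.2 p hp
    have hc : c ∈ S := by
      rw [hn.2.2.2] at hpq hpr
      grind
    exact ⟨c, b, hn.perm_right, hc, hb⟩

theorem IsTwinned.ne_of_hasNeighbors (h : IsTwinned g X) (hg : 4 ≤ g) {u v a b c d : V}
    (hu : HasNeighbors X u v a b) (hv : HasNeighbors X v u c d) :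
    a ≠ c ∧ a ≠ d ∧ b ≠ c ∧ b ≠ d := by
  have huv : X.Adj u v := (hu.2.2.2 v).2 (by simp)
  have hua : X.Adj u a := (hu.2.2.2 a).2 (by simp)
  have hub : X.Adj u b := (hu.2.2.2 b).2 (by simp)
  have hvc : X.Adj v c := (hv.2.2.2 c).2 (by simp)
  have hvd : X.Adj v d := (hv.2.2.2 d).2 (by simp)
  have h1 := h.not_adj hg huv hua
  have h2 := h.not_adj hg huv hub
  refine ⟨?_, ?_, ?_, ?_⟩ <;> rintro rfl <;> contradiction

theorem IsTwinned.add_two_le (h : IsTwinned g X) (hg : 4 ≤ g) {S : Finset V} (hS : IsCore X S)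
    (hcard : S.card = g) : g + 2 ≤ Fintype.card V := by
  obtain ⟨u, hu⟩ := hS.1
  obtain ⟨v, hv, -, -, -, huv, -⟩ := hS.2 u hu
  obtain ⟨a, b, hnu, ha, hb⟩ := h.exists_hasNeighbors hS hcard hu hv huv
  obtain ⟨c, d, hnv, hc, hd⟩ := h.exists_hasNeighbors hS hcard hv hu huv.symm
  have hbd := (h.ne_of_hasNeighbors hg hnu hnv).2.2.2
  have h1 : (insert b (insert d S)).card = g + 2 := by
    rw [Finset.card_insert_of_notMem (by simp [hbd, hb]), Finset.card_insert_of_notMem hd, hcard]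
  rw [← h1]
  exact Finset.card_le_univ _

theorem IsTwinned.of_isTwin (h : IsTwinned g X) (hg : 4 ≤ g) {S : Finset V} (hS : IsCore X S)
    (hcard : S.card = g) (hZ : IsTwin X Z) :
    IsTwinned g Z ∧ (coresOfCard Z g).card = (coresOfCard X g).card := by
  have hn := h.add_two_le hg hS hcard
  have hk : ∀ k ≤ g, (coresOfCard Z k).card = (coresOfCard X k).card := fun k hk ↦
    (hZ.2.2.1.card_coresOfCard (k := k) (by omega) (by omega)).symm
  refine ⟨⟨fun T hT ↦ ?_, X, hZ.symm⟩, hk g le_rfl⟩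
  by_contra! hlt
  have hpos : 0 < (coresOfCard Z T.card).card :=
    Finset.card_pos.2 ⟨T, mem_coresOfCard.2 ⟨hT, rfl⟩⟩
  rw [hk _ hlt.le, Finset.card_pos] at hpos
  obtain ⟨T', hT'⟩ := hpos
  obtain ⟨hT', hc⟩ := mem_coresOfCard.1 hT'
  have := h.1 T' hT'
  omega

/-- A redrawing which attaches both outer cycle neighbours to the same end of an edge of a minimum
core would create a smaller core. -/
theorem IsTwinned.not_hasNeighbors (h : IsTwinned g X) (hZ : ∀ S, IsCore Z S → g ≤ S.card)
    {S : Finset V} (hS : IsCore X S) (hcard : S.card = g) {u v a b c d : V}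
    (hu : HasNeighbors X u v a b) (hv : HasNeighbors X v u c d) (hac : a ≠ c)
    (hag : ∀ p q, p ≠ u → p ≠ v → q ≠ u → q ≠ v → (Z.Adj p q ↔ X.Adj p q))
    (huS : u ∈ S) (hvS : v ∈ S) (haS : a ∈ S) (hcS : c ∈ S) (hZu : HasNeighbors Z u v a c) :
    False := by
  have hd := h.notMem hS hcard hvS hv huS hcS
  have hb := h.notMem hS hcard huS hu hvS haS
  obtain ⟨hva, hvb, hab, hu⟩ := hu
  obtain ⟨huc, hud, hcd, hv⟩ := hv
  obtain ⟨-, hvc, -, hZu⟩ := hZu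
  have hcore : IsCore Z (S.erase v) := by
    refine ⟨⟨a, by simp [haS, hva.symm]⟩, fun p hp ↦ ?_⟩
    obtain ⟨hpv, hp⟩ := Finset.mem_erase.1 hp
    by_cases hpu : p = u
    · subst hpu
      exact ⟨a, by simp [haS, hva.symm], c, by simp [hcS, hvc.symm], hac, (hZu a).2 (by simp),
        (hZu c).2 (by simp)⟩
    have hstep : ∀ q ∈ S, X.Adj p q → q ≠ v → Z.Adj p q := by
      intro q hq hpq hqv
      by_cases hqu : q = u
      · subst hqu
        have := (hu p).1 hpq.symm
        have hpa : p = a := by grind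
        exact ((hZu p).2 (by simp [hpa])).symm
      · exact (hag p q hpu hpv hqu hqv).2 hpq
    have hstep' : ∀ q ∈ S, X.Adj p q → q = v → Z.Adj p u ∧ ¬ X.Adj p u := by
      rintro q hq hpq rfl
      have := (hv p).1 hpq.symm
      have hpc : p = c := by grind
      subst hpc
      refine ⟨((hZu p).2 (by simp)).symm, fun hn ↦ ?_⟩
      have := (hu p).1 hn.symm
      grind
    obtain ⟨q, hq, r, hr, hqr, hpq, hpr⟩ := hS.2 p hp
    have huv : u ≠ v := by
      rintro rfl
      simpa using (hu u).2 (Or.inl rfl)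
    by_cases hqv : q = v
    · obtain ⟨h1, h2⟩ := hstep' q hq hpq hqv
      have hrv : r ≠ v := hqv ▸ hqr.symm
      refine ⟨u, by simp [huv, huS], r, by simp [hr, hrv], ?_, h1, hstep r hr hpr hrv⟩
      rintro rfl
      exact h2 hpr
    by_cases hrv : r = v
    · obtain ⟨h1, h2⟩ := hstep' r hr hpr hrv
      refine ⟨u, by simp [huv, huS], q, by simp [hq, hqv], ?_, h1, hstep q hq hpq hqv⟩
      rintro rfl
      exact h2 hpq
    exact ⟨q, by simp [hq, hqv], r, by simp [hr, hrv], hqr, hstep q hq hpq hqv,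
      hstep r hr hpr hrv⟩
  have h1 := hZ _ hcore
  rw [Finset.card_erase_of_mem hvS] at h1
  have := Finset.card_pos.2 ⟨v, hvS⟩
  omega

/-- Along an edge of a minimum core, the twin can be redrawn so as to swap the two pendants. -/
theorem IsTwinned.exists_swap (h : IsTwinned g X) (hg : 4 ≤ g) {S : Finset V} (hS : IsCore X S)
    (hcard : S.card = g) {u v a b c d : V} (hu : HasNeighbors X u v a b)
    (hv : HasNeighbors X v u c d) (huS : u ∈ S) (hvS : v ∈ S) (haS : a ∈ S) (hcS : c ∈ S) :
    ∃ Z, IsTwinned g Z ∧ (coresOfCard Z g).card = (coresOfCard X g).card ∧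
      (∀ p q, p ≠ u → p ≠ v → q ≠ u → q ≠ v → (Z.Adj p q ↔ X.Adj p q)) ∧
      HasNeighbors Z u v a d ∧ HasNeighbors Z v u b c := by
  obtain ⟨Y, hY⟩ := h.2
  obtain ⟨hac, had, hbc, hbd⟩ := h.ne_of_hasNeighbors hg hu hv
  obtain ⟨Z, hZ, hag, hZ'⟩ := hY.exists_agree_edge hu hv hac had hbc hbd
  obtain ⟨hZ1, hZ2⟩ := h.of_isTwin hg hS hcard hZ
  rcases hZ' with ⟨h1, h2⟩ | h1
  · exact (h.not_hasNeighbors hZ1.1 hS hcard hu hv hac hag huS hvS haS hcS h1).elim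
  · exact ⟨Z, hZ1, hZ2, hag, h1⟩

/-- Two minimum cores with a common path on three vertices coincide. -/
theorem IsTwinned.core_unique (h : IsTwinned g X) (hg : 4 ≤ g) {S T : Finset V} (hS : IsCore X S)
    (hScard : S.card = g) (hT : IsCore X T) (hTcard : T.card = g) {p q r : V} (hpr : p ≠ r)
    (hqp : X.Adj q p) (hqr : X.Adj q r) (hpS : p ∈ S) (hqS : q ∈ S) (hrS : r ∈ S)
    (hpT : p ∈ T) (hqT : q ∈ T) (hrT : r ∈ T) : S = T := by
  classical
  let Z : Finset V := {v ∈ S ∩ T | ∃ a b, a ≠ b ∧ a ∈ S ∩ T ∧ b ∈ S ∩ T ∧ X.Adj v a ∧ X.Adj v b}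
  have hZ : ∀ v, v ∈ Z ↔ v ∈ S ∩ T ∧ ∃ a b, a ≠ b ∧ a ∈ S ∩ T ∧ b ∈ S ∩ T ∧ X.Adj v a ∧
      X.Adj v b := by simp [Z]
  have hqZ : q ∈ Z := by
    rw [hZ]
    exact ⟨by simp [*], p, r, hpr, by simp [*], by simp [*], hqp, hqr⟩
  have hclosed : ∀ v ∈ Z, ∀ u ∈ S ∩ T, X.Adj v u → u ∈ Z := by
    intro v hv u hu hvu
    by_contra huZ
    obtain ⟨hvST, x, y, hxy, hx, hy, hvx, hvy⟩ := (hZ v).1 hv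
    simp only [Finset.mem_inter] at hu hvST hx hy
    obtain ⟨c, d, hnv, hcS, hdS⟩ := h.exists_hasNeighbors hS hScard hvST.1 hu.1 hvu
    have hcT : c ∈ T := by
      have hx' := (hnv.2.2.2 x).1 hvx
      have hy' := (hnv.2.2.2 y).1 hvy
      grind
    obtain ⟨a, b, hnu, haS, hbS⟩ := h.exists_hasNeighbors hS hScard hu.1 hvST.1 hvu.symm
    obtain ⟨b', a', hnu', hbT, haT⟩ := h.exists_hasNeighbors hT hTcard hu.2 hvST.2 hvu.symm
    have hnb := (hnu.2.2.2 b').1 ((hnu'.2.2.2 b').2 (by simp))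
    have hva : v ≠ a := hnu.1
    have hvb' : v ≠ b' := hnu'.1
    have haT : a ∉ T := by
      intro haT
      refine huZ ((hZ u).2 ⟨by simp [hu], v, a, hva, by simp [hvST], by simp [haS, haT], hvu.symm,
        (hnu.2.2.2 a).2 (by simp)⟩)
    have hbb : b' = b := by grind
    subst hbb
    obtain ⟨Y, hY⟩ := h.2
    obtain ⟨hac, had, hbc, hbd⟩ := h.ne_of_hasNeighbors hg hnu hnv
    obtain ⟨W, hW, hag, hW'⟩ := hY.exists_agree_edge hnu hnv hac had hbc hbd
    have hW1 := (h.of_isTwin hg hS hScard hW).1.1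
    rcases hW' with ⟨h1, -⟩ | ⟨-, h1⟩
    · exact h.not_hasNeighbors hW1 hS hScard hnu hnv hac hag hu.1 hvST.1 haS hcS h1
    · refine h.not_hasNeighbors hW1 hT hTcard hnv hnu.perm_right hbc.symm ?_ hvST.2 hu.2 hcT hbT
        h1.perm_right
      exact fun p q h1 h2 h3 h4 ↦ hag p q h2 h1 h4 h3
  have hcore : IsCore X Z := by
    refine ⟨⟨q, hqZ⟩, fun v hv ↦ ?_⟩
    obtain ⟨-, x, y, hxy, hx, hy, hvx, hvy⟩ := (hZ v).1 hv
    exact ⟨x, hclosed v hv x hx hvx, y, hclosed v hv y hy hvy, hxy, hvx, hvy⟩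
  have hle := h.1 Z hcore
  have hsub : Z ⊆ S ∩ T := Finset.filter_subset _ _
  have h1 : Z = S := Finset.eq_of_subset_of_card_le (hsub.trans Finset.inter_subset_left) (by omega)
  have h2 : Z = T :=
    Finset.eq_of_subset_of_card_le (hsub.trans Finset.inter_subset_right) (by omega)
  exact h1.symm.trans h2

end

/-- A minimum core `f` of a twinned graph, traversed cyclically, together with the neighbours `P`
outside the core. -/
structure IsFrame {V : Type*} [Fintype V] [DecidableEq V] {m : ℕ} (X : SimpleGraph V)
    (f P : Fin (m + 1) → V) : Prop where
  three_le : 3 ≤ m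
  twinned : IsTwinned (m + 1) X
  injective : Function.Injective f
  ne : ∀ i j, f i ≠ P j
  hasNeighbors : ∀ i, HasNeighbors X (f i) (f (i - 1)) (f (i + 1)) (P i)

/-- The graph `Y` arises from `X` by permuting the outer neighbours of the core `f` along `σ`,
without affecting the number of minimum cores. -/
structure IsArrangement {V : Type*} [Fintype V] [DecidableEq V] {m : ℕ} (X : SimpleGraph V)
    (f P : Fin (m + 1) → V) (σ : Equiv.Perm (Fin (m + 1))) (Y : SimpleGraph V) : Prop where
  twinned : IsTwinned (m + 1) Y
  card_eq : (coresOfCard Y (m + 1)).card = (coresOfCard X (m + 1)).card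
  agree : ∀ p q, (∀ i, f i ≠ p) → (∀ i, f i ≠ q) → (Y.Adj p q ↔ X.Adj p q)
  hasNeighbors : ∀ i, HasNeighbors Y (f i) (f (i - 1)) (f (i + 1)) (P (σ i))

section

variable {V : Type*} [Fintype V] [DecidableEq V] {m : ℕ} {X Y Z : SimpleGraph V}
  {f P : Fin (m + 1) → V} {σ : Equiv.Perm (Fin (m + 1))}

theorem IsTwinned.exists_isFrame (h : IsTwinned (m + 1) X) (hm : 3 ≤ m) {S : Finset V}
    (hS : IsCore X S) (hcard : S.card = m + 1) :
    ∃ f P : Fin (m + 1) → V, IsFrame X f P ∧ Finset.univ.image f = S := by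
  obtain ⟨v, hv⟩ := hS.1
  obtain ⟨f, hinj, hmem, hadj, -⟩ := exists_enumeration h.1 hS hcard hv
  have hfS : ∀ i, f i ∈ S := fun i ↦ (hmem _).2 ⟨i, rfl⟩
  have hP : ∀ i, ∃ p, HasNeighbors X (f i) (f (i - 1)) (f (i + 1)) p ∧ p ∉ S := by
    intro i
    have h1 : X.Adj (f i) (f (i - 1)) := by simpa using (hadj (i - 1)).symm
    have hne : f (i - 1) ≠ f (i + 1) := by
      refine hinj.ne fun heq ↦ ?_
      rw [sub_eq_iff_eq_add, add_assoc, left_eq_add] at heq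
      have := congrArg Fin.val heq
      rw [Fin.val_add, Fin.val_one', Fin.val_zero, Nat.mod_eq_of_lt (by omega : 1 < m + 1),
        Nat.mod_eq_of_lt (by omega)] at this
      omega
    obtain ⟨b, c, hn, hb, hc⟩ := h.exists_hasNeighbors hS hcard (hfS i) (hfS (i - 1)) h1
    have hb' : f (i + 1) = b := by
      rcases (hn.2.2.2 _).1 (hadj i) with h' | h' | h'
      · exact (hne h'.symm).elim
      · exact h'
      · exact (hc (h' ▸ hfS _)).elim
    exact ⟨c, hb' ▸ hn, hc⟩
  choose P hP hPS using hP
  refine ⟨f, P, ⟨hm, h, hinj, fun i j hij ↦ hPS j (hij ▸ hfS i), hP⟩, ?_⟩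
  ext p
  simp [hmem]

theorem IsFrame.isArrangement_one (h : IsFrame X f P) : IsArrangement X f P 1 X :=
  ⟨h.twinned, rfl, fun _ _ _ _ ↦ Iff.rfl, h.hasNeighbors⟩

theorem IsFrame.card_image (h : IsFrame X f P) : (Finset.univ.image f).card = m + 1 := by
  rw [Finset.card_image_of_injective _ h.injective]
  simp

theorem IsArrangement.isCore (h : IsArrangement X f P σ Y) :
    IsCore Y (Finset.univ.image f) := by
  refine ⟨⟨f 0, by simp⟩, fun p hp ↦ ?_⟩
  obtain ⟨i, -, rfl⟩ := Finset.mem_image.1 hp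
  obtain ⟨h1, -, -, h2⟩ := h.hasNeighbors i
  exact ⟨f (i - 1), by simp, f (i + 1), by simp, h1, (h2 _).2 (by simp), (h2 _).2 (by simp)⟩

theorem IsArrangement.exists_swap (hX : IsFrame X f P) (h : IsArrangement X f P σ Y)
    (k : Fin (m + 1)) : ∃ Z, IsArrangement X f P (σ * Equiv.swap k (k + 1)) Z := by
  have hu := (h.hasNeighbors k).perm_left
  have hv := h.hasNeighbors (k + 1)
  rw [add_sub_cancel_right] at hv
  obtain ⟨Z, hZ, hcard, hag, hZu, hZv⟩ := h.twinned.exists_swap (by have := hX.three_le; omega)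
    h.isCore hX.card_image hu hv (by simp) (by simp) (by simp) (by simp)
  refine ⟨Z, hZ, hcard.trans h.card_eq, fun p q hp hq ↦ ?_, fun i ↦ ?_⟩
  · rw [hag p q (hp _).symm (hp _).symm (hq _).symm (hq _).symm, h.agree p q hp hq]
  · by_cases hik : i = k
    · subst hik
      rw [Equiv.Perm.mul_apply, Equiv.swap_apply_left]
      exact hZu.perm_left
    by_cases hik' : i = k + 1
    · subst hik'
      rw [Equiv.Perm.mul_apply, Equiv.swap_apply_right, add_sub_cancel_right]
      exact hZv.perm_right
    rw [Equiv.Perm.mul_apply, Equiv.swap_apply_of_ne_of_ne hik hik']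
    obtain ⟨h1, h2, h3, h4⟩ := h.hasNeighbors i
    refine ⟨h1, h2, h3, fun q ↦ ?_⟩
    rw [← h4]
    have hfk := hX.injective.ne hik
    have hfk' := hX.injective.ne hik'
    by_cases hqu : q = f k
    · have hn := hX.ne i
      rw [hqu, Z.adj_comm, Y.adj_comm, hZu.2.2.2, hu.2.2.2]
      simp [hn]
    by_cases hqv : q = f (k + 1)
    · have hn := hX.ne i
      rw [hqv, Z.adj_comm, Y.adj_comm, hZv.2.2.2, hv.2.2.2]
      simp [hn]
    exact hag _ _ hfk hfk' hqu hqv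

theorem IsFrame.exists_isArrangement (hX : IsFrame X f P) (σ : Equiv.Perm (Fin (m + 1))) :
    ∃ Y, IsArrangement X f P σ Y := by
  have hσ : σ ∈ Submonoid.closure
      (Set.range fun i : Fin m ↦ Equiv.swap i.castSucc i.succ) := by
    rw [Equiv.Perm.mclosure_swap_castSucc_succ]
    trivial
  induction hσ using Submonoid.closure_induction_right with
  | one => exact ⟨X, hX.isArrangement_one⟩
  | mul_right σ _ τ hτ ih =>
    obtain ⟨k, rfl⟩ := hτ
    obtain ⟨Y, hY⟩ := ih
    simpa [Fin.coeSucc_eq_succ] using hY.exists_swap hX k.castSucc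

end

theorem exists_perm_image_eq {ι : Type*} [Fintype ι] [DecidableEq ι] {I J : Finset ι}
    (h : I.card = J.card) : ∃ σ : Equiv.Perm ι, I.image σ = J := by
  let e : {i // i ∈ I} ≃ {i // i ∈ J} := Finset.equivOfCardEq h
  refine ⟨e.extendSubtype, Finset.eq_of_subset_of_card_le ?_ ?_⟩
  · intro x hx
    obtain ⟨i, hi, rfl⟩ := Finset.mem_image.1 hx
    exact e.extendSubtype_mem i hi
  · rw [Finset.card_image_of_injective _ e.extendSubtype.injective, h]

theorem exists_perm_apply_eq {ι : Type*} {a b c d a' b' c' d' : ι}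
    (h : [a, b, c, d].Nodup) (h' : [a', b', c', d'].Nodup) :
    ∃ σ : Equiv.Perm ι, σ a = a' ∧ σ b = b' ∧ σ c = c' ∧ σ d = d' := by
  have hinj : ∀ {a b c d : ι}, [a, b, c, d].Nodup → Function.Injective ![a, b, c, d] := by
    intro a b c d h i j
    simp only [List.nodup_cons, List.mem_cons, List.not_mem_nil] at h
    fin_cases i <;> fin_cases j <;> simp <;> grind
  have := Equiv.Perm.isMultiplyPretransitive ι 4
  obtain ⟨σ, hσ⟩ := MulAction.exists_smul_eq (Equiv.Perm ι) (⟨_, hinj h⟩ : Fin 4 ↪ ι) ⟨_, hinj h'⟩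
  have key := fun i ↦ DFunLike.congr_fun hσ i
  exact ⟨σ, key 0, key 1, key 2, key 3⟩

theorem Fin.nodup_of_three_le {m : ℕ} (hm : 3 ≤ m) :
    ([0, 1, 1 + 1, 1 + 1 + 1] : List (Fin (m + 1))).Nodup := by
  have h1 : ((1 : Fin (m + 1)) : ℕ) = 1 := by
    rw [Fin.val_one', Nat.mod_eq_of_lt (by omega)]
  have h2 : ((1 + 1 : Fin (m + 1)) : ℕ) = 2 := by
    rw [Fin.val_add, h1, Nat.mod_eq_of_lt (by omega)]
  have h3 : ((1 + 1 + 1 : Fin (m + 1)) : ℕ) = 3 := by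
    rw [Fin.val_add, h2, h1, Nat.mod_eq_of_lt (by omega)]
  simp only [List.nodup_cons, List.mem_cons, List.not_mem_nil, Fin.ext_iff, h1, h2, h3,
    Fin.val_zero]
  simp

/-- `T` avoids the core `f`, contains the outer neighbours with index in `A`, and becomes a core
after attaching each of these to one more vertex. -/
def IsLink {V ι : Type*} (X : SimpleGraph V) (f P : ι → V) (T : Finset V) (A : Finset ι) : Prop :=
  (∀ i ∈ A, P i ∈ T) ∧ ∀ t ∈ T, (∀ i, f i ≠ t) ∧
    ((∃ q ∈ T, ∃ r ∈ T, q ≠ r ∧ X.Adj t q ∧ X.Adj t r) ∨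
      ((∃ i ∈ A, P i = t) ∧ ∃ q ∈ T, X.Adj t q))

theorem IsLink.card_union {V ι : Type*} [DecidableEq V] {X : SimpleGraph V} {f P : ι → V}
    {T : Finset V} {A : Finset ι} (hT : IsLink X f P T A) (hf : Function.Injective f)
    (J : Finset ι) : (T ∪ J.image f).card = T.card + J.card := by
  rw [Finset.card_union_of_disjoint, Finset.card_image_of_injective _ hf]
  rw [Finset.disjoint_left]
  intro p hp hp'
  obtain ⟨j, -, rfl⟩ := Finset.mem_image.1 hp'
  exact (hT.2 _ hp).1 j rfl

section

variable {V : Type*} [Fintype V] [DecidableEq V] {m : ℕ} {X Y Z : SimpleGraph V}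
  {f P : Fin (m + 1) → V} {σ : Equiv.Perm (Fin (m + 1))} {S T : Finset V}

theorem IsFrame.injective_right (hX : IsFrame X f P) : Function.Injective P := by
  intro i j hij
  by_contra hne
  have hnd := Fin.nodup_of_three_le hX.three_le
  have h01 : (0 : Fin (m + 1)) ≠ 1 := by
    simp only [List.nodup_cons, List.mem_cons] at hnd
    grind
  obtain ⟨τ, hτ⟩ := exists_perm_image_eq (I := ({0, 1} : Finset (Fin (m + 1)))) (J := {i, j})
    (by rw [Finset.card_pair h01, Finset.card_pair hne])
  have h0 : τ 0 ∈ ({i, j} : Finset _) := hτ ▸ Finset.mem_image_of_mem τ (by simp)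
  have h1 : τ 1 ∈ ({i, j} : Finset _) := hτ ▸ Finset.mem_image_of_mem τ (by simp)
  have hP : P (τ 0) = P (τ 1) := by
    rw [Finset.mem_insert, Finset.mem_singleton] at h0 h1
    grind
  obtain ⟨Y, hY⟩ := hX.exists_isArrangement τ
  have hn0 := (hY.hasNeighbors 0).2.2.2
  have hn1 := (hY.hasNeighbors 1).2.2.2
  refine hY.twinned.not_adj (by have := hX.three_le; omega) ((hn0 (f 1)).2 (by simp))
    ((hn0 (P (τ 0))).2 (by simp)) ?_
  rw [hP]
  exact (hn1 _).2 (by simp)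

theorem IsArrangement.isCore_union (h : IsArrangement X f P σ Y) {J : Finset (Fin (m + 1))}
    (hT : IsLink X f P T (J.image σ)) (hJ : J.Nonempty)
    (hJ' : ∀ j ∈ J, j - 1 ∈ J ∨ j + 1 ∈ J) : IsCore Y (T ∪ J.image f) := by
  refine ⟨(hJ.image f).mono Finset.subset_union_right, fun p hp ↦ ?_⟩
  rcases Finset.mem_union.1 hp with hp | hp
  · obtain ⟨hpf, ⟨q, hq, r, hr, hqr, hpq, hpr⟩ | ⟨⟨i, hi, rfl⟩, q, hq, hpq⟩⟩ := hT.2 p hp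
    · exact ⟨q, by simp [hq], r, by simp [hr], hqr, (h.agree p q hpf (hT.2 q hq).1).2 hpq,
        (h.agree p r hpf (hT.2 r hr).1).2 hpr⟩
    · obtain ⟨j, hj, rfl⟩ := Finset.mem_image.1 hi
      exact ⟨f j, Finset.mem_union_right _ (Finset.mem_image_of_mem f hj), q, by simp [hq],
        (hT.2 q hq).1 j, (((h.hasNeighbors j).2.2.2 _).2 (by simp)).symm,
        (h.agree _ q hpf (hT.2 q hq).1).2 hpq⟩
  · obtain ⟨j, hj, rfl⟩ := Finset.mem_image.1 hp
    have hPj := hT.1 _ (Finset.mem_image_of_mem σ hj)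
    have hn := (h.hasNeighbors j).2.2.2
    rcases hJ' j hj with hj' | hj'
    · exact ⟨f (j - 1), Finset.mem_union_right _ (Finset.mem_image_of_mem f hj'), P (σ j),
        by simp [hPj], (hT.2 _ hPj).1 _, (hn _).2 (by simp), (hn _).2 (by simp)⟩
    · exact ⟨f (j + 1), Finset.mem_union_right _ (Finset.mem_image_of_mem f hj'), P (σ j),
        by simp [hPj], (hT.2 _ hPj).1 _, (hn _).2 (by simp), (hn _).2 (by simp)⟩

theorem IsFrame.isLink (hX : IsFrame X f P) (hY : IsArrangement X f P σ Y) (hS : IsCore Y S)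
    (hcard : S.card = m + 1) (hne : S ≠ Finset.univ.image f) {J : Finset (Fin (m + 1))}
    (hJ : ∀ j, j ∈ J ↔ f j ∈ S) :
    IsLink X f P (S \ Finset.univ.image f) (J.image σ) ∧ ∀ j ∈ J, j - 1 ∈ J ∨ j + 1 ∈ J := by
  have hg : 4 ≤ m + 1 := by have := hX.three_le; omega
  have hboth : ∀ j, f j ∈ S → f (j - 1) ∈ S → f (j + 1) ∉ S := by
    intro j h0 h1 h2
    have hn := hY.hasNeighbors j
    exact hne (hY.twinned.core_unique hg hS hcard hY.isCore hX.card_image hn.1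
      ((hn.2.2.2 _).2 (by simp)) ((hn.2.2.2 _).2 (by simp)) h1 h0 h2 (by simp) (by simp) (by simp))
  have hrim : ∀ j, f j ∈ S → P (σ j) ∈ S ∧ (f (j - 1) ∈ S ∨ f (j + 1) ∈ S) := by
    intro j hj
    obtain ⟨q, hq, r, hr, hqr, hjq, hjr⟩ := hS.2 _ hj
    rw [(hY.hasNeighbors j).2.2.2] at hjq hjr
    have := hboth j hj
    grind
  refine ⟨⟨fun i hi ↦ ?_, fun t ht ↦ ?_⟩, fun j hj ↦ ?_⟩
  · obtain ⟨j, hj, rfl⟩ := Finset.mem_image.1 hi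
    simp [(hrim j ((hJ j).1 hj)).1, hX.ne]
  · simp only [Finset.mem_sdiff, Finset.mem_image, Finset.mem_univ, true_and, not_exists] at ht ⊢
    obtain ⟨htS, htf⟩ := ht
    refine ⟨htf, ?_⟩
    have hrim' : ∀ j, Y.Adj t (f j) → P (σ j) = t := by
      intro j hj
      rcases ((hY.hasNeighbors j).2.2.2 t).1 hj.symm with h | h | h
      · exact (htf _ h.symm).elim
      · exact (htf _ h.symm).elim
      · exact h.symm
    obtain ⟨q, hq, r, hr, hqr, htq, htr⟩ := hS.2 t htS
    by_cases hqf : ∃ j, f j = q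
    · obtain ⟨j, rfl⟩ := hqf
      have hrf : ∀ i, f i ≠ r := by
        rintro i rfl
        have := hX.injective_right ((hrim' j htq).trans (hrim' i htr).symm)
        exact hqr (congrArg f (σ.injective this))
      exact Or.inr ⟨⟨σ j, ⟨j, (hJ j).2 hq, rfl⟩, hrim' j htq⟩, r, ⟨hr, hrf⟩,
        (hY.agree t r htf hrf).1 htr⟩
    by_cases hrf : ∃ j, f j = r
    · obtain ⟨j, rfl⟩ := hrf
      rw [not_exists] at hqf
      exact Or.inr ⟨⟨σ j, ⟨j, (hJ j).2 hr, rfl⟩, hrim' j htr⟩, q, ⟨hq, hqf⟩,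
        (hY.agree t q htf hqf).1 htq⟩
    rw [not_exists] at hqf hrf
    exact Or.inl ⟨q, ⟨hq, hqf⟩, r, ⟨hr, hrf⟩, hqr, (hY.agree t q htf hqf).1 htq,
      (hY.agree t r htf hrf).1 htr⟩
  · simp only [hJ] at hj ⊢
    exact (hrim j hj).2

/-- A minimum core meeting the frame core `f` meets it in an edge. -/
theorem IsFrame.exists_isLink (hX : IsFrame X f P) (hY : IsArrangement X f P σ Y)
    (hS : IsCore Y S) (hcard : S.card = m + 1) (hne : S ≠ Finset.univ.image f)
    {i : Fin (m + 1)} (hi : f i ∈ S) :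
    ∃ k T, IsLink X f P T {σ k, σ (k + 1)} ∧ T.card + 2 = m + 1 ∧ S = T ∪ {f k, f (k + 1)} := by
  have hnd := Fin.nodup_of_three_le hX.three_le
  have hg : 4 ≤ m + 1 := by have := hX.three_le; omega
  have h01 : (0 : Fin (m + 1)) ≠ 1 := by
    simp only [List.nodup_cons, List.mem_cons] at hnd
    grind
  let J : Finset (Fin (m + 1)) := {j | f j ∈ S}
  have hJ : ∀ j, j ∈ J ↔ f j ∈ S := by simp [J]
  obtain ⟨hT, hJ'⟩ := hX.isLink hY hS hcard hne hJ
  set T := S \ Finset.univ.image f with hTdef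
  have hST : S = T ∪ J.image f := by
    ext p
    simp only [hTdef, Finset.mem_union, Finset.mem_sdiff, Finset.mem_image, Finset.mem_univ,
      true_and, hJ]
    grind
  have hcardT : T.card + J.card = m + 1 := by rw [← hT.card_union hX.injective, ← hST, hcard]
  have hiJ : i ∈ J := (hJ i).2 hi
  have hpair : ∃ k, {k, k + 1} ⊆ J := by
    rcases hJ' i hiJ with h | h
    · exact ⟨i - 1, by simp [Finset.insert_subset_iff, h, hiJ]⟩
    · exact ⟨i, by simp [Finset.insert_subset_iff, h, hiJ]⟩
  obtain ⟨k, hk⟩ := hpair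
  have hkcard : ({k, k + 1} : Finset (Fin (m + 1))).card = 2 :=
    Finset.card_pair (by simpa using h01.symm)
  rcases (hkcard ▸ Finset.card_le_card hk : 2 ≤ J.card).eq_or_lt with hJ2 | hJ3
  · have hkJ : {k, k + 1} = J := Finset.eq_of_subset_of_card_le hk (by omega)
    refine ⟨k, T, ?_, by omega, ?_⟩
    · have : J.image σ = {σ k, σ (k + 1)} := by simp [← hkJ, Finset.image_insert]
      rwa [← this]
    · rw [hST, ← hkJ]
      simp [Finset.image_insert]
  · exfalso
    have hPT := hT.1 _ (Finset.mem_image_of_mem σ hiJ)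
    have hTpos := Finset.card_pos.2 ⟨_, hPT⟩
    let I : Finset (Fin (m + 1)) := Finset.Iio ⟨J.card, by omega⟩
    have hI : ∀ j, j ∈ I ↔ (j : ℕ) < J.card := by simp [I, Fin.lt_def]
    have hIcard : I.card = J.card := by simp [I]
    obtain ⟨τ, hτ⟩ := exists_perm_image_eq (I := I) (J := J.image σ)
      (by rw [hIcard, Finset.card_image_of_injective _ σ.injective])
    obtain ⟨Z, hZ⟩ := hX.exists_isArrangement τ
    have h1 : ((1 : Fin (m + 1)) : ℕ) = 1 := by
      rw [Fin.val_one', Nat.mod_eq_of_lt (by omega)]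
    have h2 : ((1 + 1 : Fin (m + 1)) : ℕ) = 2 := by
      rw [Fin.val_add, h1, Nat.mod_eq_of_lt (by omega)]
    have h0I : 0 ∈ I := by rw [hI, Fin.val_zero]; omega
    have h1I : 1 ∈ I := by rw [hI, h1]; omega
    have h2I : 1 + 1 ∈ I := by rw [hI, h2]; omega
    have hcore : IsCore Z (T ∪ I.image f) := by
      refine hZ.isCore_union (hτ ▸ hT) ⟨0, h0I⟩ fun j hj ↦ ?_
      rcases eq_or_ne j 0 with rfl | hj0
      · exact Or.inr (by simpa using h1I)
      · left
        rw [hI] at hj ⊢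
        rw [Fin.val_sub_one_of_ne_zero hj0]
        omega
    have hn := (hZ.hasNeighbors 1).2.2.2
    have hmem : ∀ {j}, j ∈ I → f j ∈ T ∪ I.image f := fun hj ↦
      Finset.mem_union_right _ (Finset.mem_image_of_mem f hj)
    have heq := hZ.twinned.core_unique hg hcore (by rw [hT.card_union hX.injective, hIcard, hcardT])
      hZ.isCore hX.card_image (p := f 0) (q := f 1) (r := f (1 + 1))
      (by
        apply hX.injective.ne
        rw [ne_eq, Fin.ext_iff, h2, Fin.val_zero]
        omega)
      ((hn _).2 (by simp)) ((hn _).2 (by simp)) (hmem h0I) (hmem h1I) (hmem h2I)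
      (by simp) (by simp) (by simp)
    have : P (σ i) ∈ Finset.univ.image f := heq ▸ Finset.mem_union_left _ hPT
    simp [hX.ne] at this

end

/-- The outer neighbours with indices `i` and `j` are joined by a link that a core edge completes to
a minimum core. -/
def IsLinked {V : Type*} {m : ℕ} (X : SimpleGraph V) (f P : Fin (m + 1) → V)
    (i j : Fin (m + 1)) : Prop :=
  ∃ T, IsLink X f P T {i, j} ∧ T.card + 2 = m + 1

theorem IsLinked.symm {V : Type*} {m : ℕ} {X : SimpleGraph V} {f P : Fin (m + 1) → V}
    {i j : Fin (m + 1)} (h : IsLinked X f P i j) : IsLinked X f P j i := by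
  rwa [IsLinked, Finset.pair_comm]

section

variable {V : Type*} [Fintype V] [DecidableEq V] {m : ℕ} {X Y Z : SimpleGraph V}
  {f P : Fin (m + 1) → V} {σ : Equiv.Perm (Fin (m + 1))} {S T : Finset V}

theorem IsArrangement.isCore_union_pair (hX : IsFrame X f P) (hY : IsArrangement X f P σ Y)
    {k : Fin (m + 1)} (hT : IsLink X f P T {σ k, σ (k + 1)}) (hcard : T.card + 2 = m + 1) :
    IsCore Y (T ∪ {f k, f (k + 1)}) ∧ (T ∪ {f k, f (k + 1)}).card = m + 1 := by
  have hnd := Fin.nodup_of_three_le hX.three_le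
  have h01 : (0 : Fin (m + 1)) ≠ 1 := by
    simp only [List.nodup_cons, List.mem_cons] at hnd
    grind
  have himg : ∀ g : Fin (m + 1) → V, ({k, k + 1} : Finset _).image g = {g k, g (k + 1)} := by
    simp [Finset.image_insert]
  have himgσ : ({k, k + 1} : Finset _).image σ = {σ k, σ (k + 1)} := by
    simp [Finset.image_insert]
  rw [← himg, hT.card_union hX.injective, Finset.card_pair (by simpa using h01.symm)]
  refine ⟨hY.isCore_union (himgσ ▸ hT) ⟨k, by simp⟩ fun j hj ↦ ?_, hcard⟩
  rw [Finset.mem_insert, Finset.mem_singleton] at hj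
  rcases hj with rfl | rfl
  · simp
  · simp

theorem IsFrame.isLinked_or_isLinked (hX : IsFrame X f P) {a b c d : Fin (m + 1)}
    (hab : IsLinked X f P a b) (hnd : [a, b, c, d].Nodup) :
    IsLinked X f P a c ∨ IsLinked X f P b d := by
  have hpos := Fin.nodup_of_three_le hX.three_le
  obtain ⟨σ, rfl, rfl, rfl, rfl⟩ := exists_perm_apply_eq hpos hnd
  have hpos' := hpos
  simp only [List.nodup_cons, List.mem_cons, List.not_mem_nil, or_false, not_or] at hpos'
  obtain ⟨⟨h01, h02, h03⟩, ⟨h12, h13⟩, h23, -⟩ := hpos'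
  obtain ⟨Y, hY⟩ := hX.exists_isArrangement σ
  obtain ⟨Z, hZ⟩ := hY.exists_swap hX 1
  set τ := σ * Equiv.swap 1 (1 + 1) with hτ
  have hτ1 : τ 1 = σ (1 + 1) := by simp [hτ]
  have hτ2 : τ (1 + 1) = σ 1 := by simp [hτ]
  have hτ' : ∀ k, k ≠ 1 → k ≠ 1 + 1 → τ k = σ k := by
    intro k h1 h2
    simp [hτ, Equiv.swap_apply_of_ne_of_ne h1 h2]
  obtain ⟨T, hT, hTcard⟩ := hab
  have h01' : (0 : Fin (m + 1)) + 1 = 1 := by simp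
  obtain ⟨hcore, hcard⟩ := hY.isCore_union_pair hX (k := 0) (by rwa [h01']) hTcard
  set S := T ∪ {f 0, f (0 + 1)} with hS
  have hPinj := hX.injective_right
  have hST : ∀ p, (∀ i, f i ≠ p) → (p ∈ S ↔ p ∈ T) := by
    intro p hp
    simp [hS, fun i ↦ (hp i).symm]
  have hTS : T ⊆ S := Finset.subset_union_left
  have hSZ : ¬ IsCore Z S := by
    intro hSZ
    have hne : S ≠ Finset.univ.image f := by
      intro h
      have : P (σ 0) ∈ S := hTS (hT.1 _ (by simp))
      simp [h, hX.ne] at this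
    obtain ⟨hl, -⟩ := hX.isLink hZ hSZ hcard hne (J := {j | f j ∈ S}) (by simp)
    have hf1 : f 1 ∈ S := by simp [hS]
    have hPT : P (σ 1) ∈ T := hT.1 _ (by simp)
    obtain ⟨-, ⟨q, hq, r, hr, hqr, h1, h2⟩ | ⟨⟨i, hi, hPi⟩, -⟩⟩ := hl.2 (P (σ 1))
      (by simp [hTS hPT, hX.ne])
    · simp only [Finset.mem_sdiff, Finset.mem_image, Finset.mem_univ, true_and, not_exists]
        at hq hr
      have hPf : ∀ i, f i ≠ P (σ 1) := fun i ↦ hX.ne _ _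
      rcases eq_or_eq_or_eq_of_isCore hY.twinned.1 hcore hcard (hTS hPT) hf1 hq.1 hr.1
        (((hY.hasNeighbors 1).2.2.2 _).2 (by simp)).symm ((hY.agree _ _ hPf hq.2).2 h1)
        ((hY.agree _ _ hPf hr.2).2 h2) with h | h | h
      · exact hq.2 _ h
      · exact hr.2 _ h
      · exact hqr h
    · obtain ⟨j, hj, rfl⟩ := Finset.mem_image.1 hi
      have hj2 : j = 1 + 1 := τ.injective ((hPinj hPi).trans hτ2.symm)
      have hfj : f (1 + 1) ∈ S := by simpa [hj2] using hj
      rcases Finset.mem_union.1 hfj with h | h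
      · exact (hT.2 _ h).1 _ rfl
      · simp only [h01', Finset.mem_insert, Finset.mem_singleton, hX.injective.eq_iff] at h
        grind
  have hex : ∃ S' ∈ coresOfCard Z (m + 1), S' ∉ coresOfCard Y (m + 1) := by
    by_contra! hsub
    have heq := Finset.eq_of_subset_of_card_le (fun S' h ↦ hsub S' h)
      (hY.card_eq.trans hZ.card_eq.symm).le
    have hmem : S ∈ coresOfCard Y (m + 1) := mem_coresOfCard.2 ⟨hcore, hcard⟩
    rw [← heq, mem_coresOfCard] at hmem
    exact hSZ hmem.1
  obtain ⟨S', hS', hS'Y⟩ := hex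
  rw [mem_coresOfCard] at hS' hS'Y
  have hne : S' ≠ Finset.univ.image f := by
    rintro rfl
    exact hS'Y ⟨hY.isCore, hX.card_image⟩
  have hmeet : ∃ i, f i ∈ S' := by
    by_contra! hno
    have hno' : ∀ p ∈ S', ∀ i, f i ≠ p := by
      rintro p hp i rfl
      exact hno i hp
    refine hS'Y ⟨⟨hS'.1.1, fun p hp ↦ ?_⟩, hS'.2⟩
    obtain ⟨q, hq, r, hr, hqr, hpq, hpr⟩ := hS'.1.2 p hp
    rw [hZ.agree _ _ (hno' p hp) (hno' q hq)] at hpq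
    rw [hZ.agree _ _ (hno' p hp) (hno' r hr)] at hpr
    exact ⟨q, hq, r, hr, hqr, (hY.agree _ _ (hno' p hp) (hno' q hq)).2 hpq,
      (hY.agree _ _ (hno' p hp) (hno' r hr)).2 hpr⟩
  obtain ⟨i, hi⟩ := hmeet
  obtain ⟨k, T', hT', hT'card, rfl⟩ := hX.exists_isLink hZ hS'.1 hS'.2 hne hi
  by_cases hk0 : k = 0
  · left
    rw [hk0, h01', hτ1, hτ' 0 h01 h02] at hT'
    exact ⟨T', hT', hT'card⟩
  by_cases hk2 : k = 1 + 1
  · right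
    rw [hk2, hτ2, hτ' (1 + 1 + 1) (Ne.symm h13) (Ne.symm h23)] at hT'
    exact ⟨T', hT', hT'card⟩
  exfalso
  refine hS'Y (hY.isCore_union_pair hX ?_ hT'card)
  by_cases hk1 : k = 1
  · rw [hk1, hτ1, hτ2, Finset.pair_comm] at hT'
    rwa [hk1]
  · rwa [hτ' k hk1 hk2, hτ' (k + 1) (by simpa using hk0) (by simpa using hk1)] at hT'

theorem IsFrame.false_of_triangle (hX : IsFrame X f P) (hm : m = 3) {a b c : Fin (m + 1)}
    (hab : a ≠ b) (hac : a ≠ c) (hbc : b ≠ c) (h1 : IsLinked X f P a b)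
    (h2 : IsLinked X f P a c) (h3 : IsLinked X f P b c) : False := by
  have hadj : ∀ {i j}, i ≠ j → IsLinked X f P i j → X.Adj (P i) (P j) := by
    rintro i j hij ⟨T, hT, hcard⟩
    have hPij := hX.injective_right.ne hij
    have hsub : {P i, P j} ⊆ T := by
      rw [Finset.insert_subset_iff, Finset.singleton_subset_iff]
      exact ⟨hT.1 i (by simp), hT.1 j (by simp)⟩
    have heq : {P i, P j} = T :=
      Finset.eq_of_subset_of_card_le hsub (by rw [Finset.card_pair hPij]; omega)
    have hex : ∃ q ∈ T, X.Adj (P i) q := by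
      obtain ⟨-, ⟨q, hq, -, -, -, h, -⟩ | ⟨-, q, hq, h⟩⟩ := hT.2 (P i) (hT.1 i (by simp))
      · exact ⟨q, hq, h⟩
      · exact ⟨q, hq, h⟩
    obtain ⟨q, hq, h⟩ := hex
    rw [← heq, Finset.mem_insert, Finset.mem_singleton] at hq
    rcases hq with rfl | rfl
    · exact (h.ne rfl).elim
    · exact h
  exact hX.twinned.not_adj (by omega) (hadj hab h1) (hadj hac h2) (hadj hbc h3)

theorem IsFrame.false_of_common_neighbor (hX : IsFrame X f P) {a b c d : Fin (m + 1)}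
    (hnd : [c, a, b, d].Nodup) {T₁ T₂ : Finset V} (h1 : IsLink X f P T₁ {a, b})
    (hc1 : T₁.card + 2 = m + 1) (h2 : IsLink X f P T₂ {a, c}) (hc2 : T₂.card + 2 = m + 1) {q : V}
    (hq1 : q ∈ T₁) (hq2 : q ∈ T₂) (hadj : X.Adj (P a) q) : False := by
  have hpos := Fin.nodup_of_three_le hX.three_le
  obtain ⟨σ, rfl, rfl, rfl, rfl⟩ := exists_perm_apply_eq hpos hnd
  simp only [List.nodup_cons, List.mem_cons, List.not_mem_nil, or_false, not_or] at hpos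
  obtain ⟨⟨h01, h02, h03⟩, ⟨h12, h13⟩, h23, -⟩ := hpos
  obtain ⟨Y, hY⟩ := hX.exists_isArrangement σ
  obtain ⟨hS1, hS1c⟩ := hY.isCore_union_pair hX h1 hc1
  obtain ⟨hS2, hS2c⟩ := hY.isCore_union_pair hX (k := 0) (T := T₂)
    (by rwa [zero_add, Finset.pair_comm]) hc2
  rw [zero_add] at hS2 hS2c
  have hP1 := h1.1 (σ 1) (by simp)
  have hP2 := h2.1 (σ 1) (by simp)
  have heq := hY.twinned.core_unique (by have := hX.three_le; omega) hS1 hS1c hS2 hS2c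
    (p := f 1) (q := P (σ 1)) (r := q) ((h1.2 q hq1).1 1)
    (((hY.hasNeighbors 1).2.2.2 _).2 (by simp)).symm
    ((hY.agree _ _ (h1.2 _ hP1).1 (h1.2 _ hq1).1).2 hadj)
    (by simp) (by simp [hP1]) (by simp [hq1]) (by simp) (by simp [hP2]) (by simp [hq2])
  have hmem : f 0 ∈ T₁ ∪ {f 1, f (1 + 1)} := heq ▸ by simp
  rcases Finset.mem_union.1 hmem with h | h
  · exact (h1.2 _ h).1 0 rfl
  · simp only [Finset.mem_insert, Finset.mem_singleton, hX.injective.eq_iff] at h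
    grind

theorem IsFrame.false_of_star (hX : IsFrame X f P) {a b c d : Fin (m + 1)}
    (hnd : [a, b, c, d].Nodup) (hb : IsLinked X f P a b) (hc : IsLinked X f P a c)
    (hd : IsLinked X f P a d) : False := by
  have hex : ∀ {i}, IsLinked X f P a i → ∃ T q, IsLink X f P T {a, i} ∧ T.card + 2 = m + 1 ∧
      q ∈ T ∧ X.Adj (P a) q ∧ q ≠ f a := by
    rintro i ⟨T, hT, hcard⟩
    obtain ⟨-, ⟨q, hq, -, -, -, h, -⟩ | ⟨-, q, hq, h⟩⟩ := hT.2 (P a) (hT.1 a (by simp))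
    · exact ⟨T, q, hT, hcard, hq, h, ((hT.2 q hq).1 a).symm⟩
    · exact ⟨T, q, hT, hcard, hq, h, ((hT.2 q hq).1 a).symm⟩
  obtain ⟨T₁, q₁, hT₁, hc₁, hq₁, h₁, hn₁⟩ := hex hb
  obtain ⟨T₂, q₂, hT₂, hc₂, hq₂, h₂, hn₂⟩ := hex hc
  obtain ⟨T₃, q₃, hT₃, hc₃, hq₃, h₃, hn₃⟩ := hex hd
  obtain ⟨x, y, hn⟩ := hX.twinned.isCubic.exists_hasNeighbors
    (((hX.hasNeighbors a).2.2.2 (P a)).2 (by simp)).symm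
  have hsame : q₁ = q₂ ∨ q₁ = q₃ ∨ q₂ = q₃ := by
    have e₁ := (hn.2.2.2 _).1 h₁
    have e₂ := (hn.2.2.2 _).1 h₂
    have e₃ := (hn.2.2.2 _).1 h₃
    grind
  simp only [List.nodup_cons, List.mem_cons, List.not_mem_nil, or_false, not_or] at hnd
  rcases hsame with rfl | rfl | rfl
  · exact hX.false_of_common_neighbor (d := d) (by simp; grind) hT₁ hc₁ hT₂ hc₂ hq₁ hq₂ h₁
  · exact hX.false_of_common_neighbor (d := c) (by simp; grind) hT₁ hc₁ hT₃ hc₃ hq₁ hq₃ h₁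
  · exact hX.false_of_common_neighbor (d := b) (by simp; grind) hT₂ hc₂ hT₃ hc₃ hq₂ hq₃ h₂

theorem IsFrame.not_isLinked (hX : IsFrame X f P) {a b : Fin (m + 1)} (hab : a ≠ b) :
    ¬ IsLinked X f P a b := by
  intro h
  have hm := hX.three_le
  have hfresh : ∀ A : Finset (Fin (m + 1)), A.card < m + 1 → ∃ x, x ∉ A := by
    intro A hA
    by_contra! hall
    have := Finset.eq_univ_iff_forall.2 hall
    simp [this] at hA
  obtain ⟨c, hc⟩ := hfresh {a, b} (Finset.card_le_two.trans_lt (by omega))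
  obtain ⟨d, hd⟩ := hfresh {a, b, c} (Finset.card_le_three.trans_lt (by omega))
  simp only [Finset.mem_insert, Finset.mem_singleton, not_or] at hc hd
  obtain ⟨hca, hcb⟩ := hc
  obtain ⟨hda, hdb, hdc⟩ := hd
  have htri : ∀ {a b c d : Fin (m + 1)}, [a, b, c, d].Nodup → IsLinked X f P a b →
      IsLinked X f P a c → IsLinked X f P b c → False := by
    intro a b c d hnd h1 h2 h3
    have hnd' := hnd
    simp only [List.nodup_cons, List.mem_cons, List.not_mem_nil, or_false, not_or] at hnd'
    rcases hm.eq_or_lt with hm3 | hm4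
    · exact hX.false_of_triangle hm3.symm (by grind) (by grind) (by grind) h1 h2 h3
    · obtain ⟨e, he⟩ := hfresh {a, b, c, d} (Finset.card_le_four.trans_lt (by omega))
      simp only [Finset.mem_insert, Finset.mem_singleton, not_or] at he
      rcases hX.isLinked_or_isLinked (c := d) (d := e) h1 (by simp; grind) with h4 | h4
      · exact hX.false_of_star hnd h1 h2 h4
      · exact hX.false_of_star (a := b) (b := a) (c := c) (d := e) (by simp; grind) h1.symm h3 h4
  have h1 := hX.isLinked_or_isLinked (c := c) (d := d) h (by simp; grind)
  have h2 := hX.isLinked_or_isLinked (c := d) (d := c) h (by simp; grind)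
  rcases h1 with h1 | h1 <;> rcases h2 with h2 | h2
  · exact hX.false_of_star (by simp; grind) h h1 h2
  · exact htri (d := d) (by simp; grind) h h1 h2
  · exact htri (d := c) (by simp; grind) h h2 h1
  · exact hX.false_of_star (a := b) (b := a) (c := c) (d := d) (by simp; grind) h.symm h2 h1

theorem IsTwinned.eq_of_card_eq_three {g : ℕ} (h : IsTwinned g X) (hS : IsCore X S)
    (hScard : S.card = 3) (hT : IsCore X T) (hTcard : T.card = 3) {x : V} (hxS : x ∈ S)
    (hxT : x ∈ T) : S = T := by
  obtain ⟨p, q, hpq, hxp, hxq, hadj, rfl⟩ := hS.exists_eq_of_card_eq_three hScard hxS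
  obtain ⟨r, s, hrs, hxr, hxs, hadj', rfl⟩ := hT.exists_eq_of_card_eq_three hTcard hxT
  obtain ⟨Y, hY⟩ := h.2
  have hcommon : ∀ {y a c}, X.Adj x y → X.Adj x a → X.Adj x c → X.Adj y a → X.Adj y c → a = c := by
    intro y a c hxy hxa hxc hya hyc
    by_contra hac
    exact hY.false_of_diamond (h.isCubic.hasNeighbors hya.ne hyc.ne hac hxy hxa hxc)
      (h.isCubic.hasNeighbors hxa.ne hxc.ne hac hxy.symm hya hyc)
  obtain ⟨a, b, c, -, -, -, hn⟩ := h.isCubic x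
  have h1 := (hn p).1 hxp
  have h2 := (hn q).1 hxq
  have h3 := (hn r).1 hxr
  have h4 := (hn s).1 hxs
  have hcases : p = r ∨ p = s ∨ q = r ∨ q = s := by grind
  rcases hcases with rfl | rfl | rfl | rfl
  · rw [hcommon hxp hxq hxs hadj hadj']
  · rw [hcommon hxp hxq hxr hadj hadj'.symm, Finset.pair_comm]
  · rw [hcommon hxq hxp hxs hadj.symm hadj', Finset.pair_comm]
  · rw [hcommon hxq hxp hxr hadj.symm hadj'.symm]

theorem IsTwinned.eq_of_mem_of_mem {g : ℕ} (h : IsTwinned g X) (hg : 3 ≤ g) (hS : IsCore X S)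
    (hScard : S.card = g) (hT : IsCore X T) (hTcard : T.card = g) {x : V} (hxS : x ∈ S)
    (hxT : x ∈ T) : S = T := by
  by_contra hne
  rcases hg.eq_or_lt with rfl | hg
  · exact hne (h.eq_of_card_eq_three hS hScard hT hTcard hxS hxT)
  · obtain ⟨m, rfl⟩ : ∃ m, g = m + 1 := ⟨g - 1, by omega⟩
    obtain ⟨f, P, hX, rfl⟩ := h.exists_isFrame (by omega) hS hScard
    obtain ⟨i, -, rfl⟩ := Finset.mem_image.1 hxS
    obtain ⟨k, R, hR, hRcard, -⟩ :=
      hX.exists_isLink hX.isArrangement_one hT hTcard (Ne.symm hne) hxT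
    have h01 : (1 : Fin (m + 1)) ≠ 0 := by
      rw [ne_eq, Fin.ext_iff, Fin.val_one', Nat.mod_eq_of_lt (by omega), Fin.val_zero]
      omega
    exact hX.not_isLinked (a := k) (b := k + 1) (by simpa using h01) ⟨R, hR, hRcard⟩

end

theorem IsCubic.of_isRegularOfDegree {V : Type*} [Fintype V] {X : SimpleGraph V}
    [DecidableRel X.Adj] (h : X.IsRegularOfDegree 3) : IsCubic X := by
  classical
  intro p
  have hp := h p
  rw [← SimpleGraph.card_neighborFinset_eq_degree, Finset.card_eq_three] at hp
  obtain ⟨a, b, c, hab, hac, hbc, hp⟩ := hp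
  refine ⟨a, b, c, hab, hac, hbc, fun q ↦ ?_⟩
  rw [← SimpleGraph.mem_neighborFinset, hp]
  simp

theorem SimpleGraph.Walk.IsCycle.mem_edges_iff {V : Type*} [DecidableEq V] {X : SimpleGraph V}
    {g : ℕ} (hmin : ∀ S, IsCore X S → g ≤ S.card) {v : V} {w : X.Walk v v} (hw : w.IsCycle)
    (hlen : w.length = g) {p q : V} :
    s(p, q) ∈ w.edges ↔ p ∈ w.support.toFinset ∧ q ∈ w.support.toFinset ∧ X.Adj p q := by
  simp only [List.mem_toFinset]
  refine ⟨fun h ↦ ⟨w.fst_mem_support_of_mem_edges h, w.snd_mem_support_of_mem_edges h,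
    w.adj_of_mem_edges h⟩, ?_⟩
  rintro ⟨hp, hq, hpq⟩
  obtain ⟨r, s, hrs, hr, hs⟩ := hw.exists_adj_toSubgraph hp
  rw [← SimpleGraph.Walk.adj_toSubgraph_iff_mem_edges]
  rcases eq_or_eq_or_eq_of_isCore hmin hw.isCore (hw.card_support_toFinset.trans hlen)
    (List.mem_toFinset.2 hp) (List.mem_toFinset.2 hq)
    (List.mem_toFinset.2 (w.mem_verts_toSubgraph.1 hr.snd_mem))
    (List.mem_toFinset.2 (w.mem_verts_toSubgraph.1 hs.snd_mem)) hpq hr.adj_sub hs.adj_sub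
    with rfl | rfl | h
  · exact hr
  · exact hs
  · exact (hrs h).elim

/-- Standing hypotheses: `G` and `H` are 3-regular graphs on the same number `n` of vertices
with the same `(n-2)`-deck, `H` is not isomorphic to `G`, and `g` is the girth of `G`. -/
theorem no_vertex_in_two_g_cycles
    {V W : Type*} [Fintype V] [Fintype W] [DecidableEq V] [DecidableEq W]
    (G : SimpleGraph V) (H : SimpleGraph W)
    [DecidableRel G.Adj] [DecidableRel H.Adj]
    (hG : G.IsRegularOfDegree 3) (hH : H.IsRegularOfDegree 3)
    (hcard : Fintype.card V = Fintype.card W)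
    (hdeck : SameDeck G H (Fintype.card V - 2))
    (hniso : ¬ Nonempty (G ≃g H))
    (g : ℕ) (hgirth : G.egirth = g)
    :
    ¬ ∃ (x : V) (v₁ v₂ : V) (C₁ : G.Walk v₁ v₁) (C₂ : G.Walk v₂ v₂),
      C₁.IsCycle ∧ C₂.IsCycle ∧ C₁.length = g ∧ C₂.length = g ∧
      x ∈ C₁.support ∧ x ∈ C₂.support ∧
      {e | e ∈ C₁.edges} ≠ {e | e ∈ C₂.edges} := by
  rintro ⟨x, v₁, v₂, C₁, C₂, h₁, h₂, hl₁, hl₂, hx₁, hx₂, hne⟩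
  obtain e : V ≃ W := Fintype.equivOfCardEq hcard
  have φ : H ≃g H.comap e := (SimpleGraph.Iso.comap e H).symm
  have hmin : ∀ S, IsCore G S → g ≤ S.card := fun S ↦ le_card_of_isCore hgirth
  have htwin : IsTwin G (H.comap e) :=
    ⟨.of_isRegularOfDegree hG, (IsCubic.of_isRegularOfDegree hH).of_iso φ, hdeck.congr_right φ,
      ⟨fun ψ ↦ hniso ⟨ψ.trans φ.symm⟩⟩⟩
  have hsupp : C₁.support.toFinset = C₂.support.toFinset :=
    IsTwinned.eq_of_mem_of_mem ⟨hmin, _, htwin⟩ (hl₁ ▸ h₁.three_le_length) h₁.isCore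
      (h₁.card_support_toFinset.trans hl₁) h₂.isCore (h₂.card_support_toFinset.trans hl₂)
      (List.mem_toFinset.2 hx₁) (List.mem_toFinset.2 hx₂)
  refine hne (Set.ext fun s ↦ ?_)
  induction s with
  | h p q =>
    change s(p, q) ∈ C₁.edges ↔ s(p, q) ∈ C₂.edges
    rw [h₁.mem_edges_iff hmin hl₁, h₂.mem_edges_iff hmin hl₂, hsupp]
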